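/- Let B⁴₃ = {(x₁,x₂,x₃) ∈ ℝ³ : x₁⁴ + x₂⁴ + x₃⁴ ≤ 1} be the superball with parameter p = 4. Then every translative packing of B⁴₃ has upper density at most 0.8743. -/

import Mathlib

open MeasureTheory Filter Metric

/-- A translative packing of `K`: a set of translation vectors such that the translates
of the interior of `K` are pairwise disjoint. -/
def IsTranslativePacking (K X : Set (EuclideanSpace ℝ (Fin 3))) : Prop :=
  ∀ x ∈ X, ∀ y ∈ X, x ≠ y →
    Disjoint ((fun z => x + z) '' interior K) ((fun z => y + z) '' interior K)

/-- The upper density of a translative packing `X` of the body `K`. -/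
noncomputable def packingUpperDensity (K X : Set (EuclideanSpace ℝ (Fin 3))) : ℝ :=
  Filter.limsup (fun r : ℝ => ⨆ c : EuclideanSpace ℝ (Fin 3),
    (volume (closedBall c r ∩ ⋃ x ∈ X, (fun z => x + z) '' K) /
      volume (closedBall c r)).toReal) Filter.atTop

namespace SB

inductive Tr
  | n0 (l r : Tr) | n1 (l r : Tr) | n2 (l r : Tr) | lf (m : Nat)

structure Cell where
  (a b c d : Nat)

def Cell.L (x : Cell) : Cell := ⟨Nat.add x.a x.b, Nat.mul 2 x.b, Nat.add x.c x.d, Nat.mul 2 x.d⟩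
def Cell.R (x : Cell) : Cell := ⟨Nat.mul 2 x.a, Nat.add x.a x.b, Nat.mul 2 x.c, Nat.add x.c x.d⟩

def pw (p q : Nat) : List Nat :=
  [Nat.pow q 11, Nat.mul (Nat.pow p 1) (Nat.pow q 10), Nat.mul (Nat.pow p 2) (Nat.pow q 9),
   Nat.mul (Nat.pow p 3) (Nat.pow q 8), Nat.mul (Nat.pow p 4) (Nat.pow q 7),
   Nat.mul (Nat.pow p 5) (Nat.pow q 6), Nat.mul (Nat.pow p 6) (Nat.pow q 5),
   Nat.mul (Nat.pow p 7) (Nat.pow q 4), Nat.mul (Nat.pow p 8) (Nat.pow q 3),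
   Nat.mul (Nat.pow p 9) (Nat.pow q 2), Nat.mul (Nat.pow p 10) (Nat.pow q 1), Nat.pow p 11]

abbrev Tab := List (List (List Nat))

noncomputable def hd (l : List Nat) : Nat := List.rec 0 (fun a _ _ => a) l
noncomputable def tl (l : List Nat) : List Nat := List.rec [] (fun _ a _ => a) l
noncomputable def dot (l : List Nat) : List Nat → Nat :=
  List.rec (fun _ => 0) (fun a _ ih bs => Nat.add (Nat.mul a (hd bs)) (ih (tl bs))) l
noncomputable def dot2 (PC : List Nat) (l : List (List Nat)) : List Nat → Nat :=
  List.rec (fun _ => 0) (fun r _ ih bs => Nat.add (Nat.mul (dot r PC) (hd bs)) (ih (tl bs))) l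
noncomputable def dot3 (PB PC : List Nat) (l : Tab) : List Nat → Nat :=
  List.rec (fun _ => 0) (fun r _ ih bs => Nat.add (Nat.mul (dot2 PC r PB) (hd bs)) (ih (tl bs))) l

def rep (W : Nat) : Nat :=
  Nat.div (Nat.sub (Nat.pow (Nat.pow 2 W) 1728) 1) (Nat.sub (Nat.pow 2 W) 1)

def nmax (a b : Nat) : Nat := Bool.rec a b (Nat.ble a b)
def Cell.bd (x : Cell) : Nat := Nat.pow (nmax (Nat.add x.a x.b) (Nat.add x.c x.d)) 11

def isNeg (W : Nat) (p n : Nat) : Bool :=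
  and (Nat.ble p n) (Nat.beq (Nat.land (Nat.sub n p) (Nat.mul (Nat.pow 2 (Nat.pred W)) (rep W))) 0)

def qp : Tab := [[], [], [[1296], [], [1296, 0, 1296]]]
def qn : Tab := [[[400]]]

noncomputable def leafW (x y z : Cell) (tp tn : Tab) (nu mu : Nat) (W : Nat) : Bool :=
  (fun X =>
  (fun PA PB PC =>
  isNeg W (Nat.add (Nat.mul nu (dot3 PB PC tp PA)) (Nat.mul mu (dot3 PB PC qp PA)))
     (Nat.add (Nat.mul nu (dot3 PB PC tn PA)) (Nat.mul mu (dot3 PB PC qn PA))))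
   ((fun Z => pw (Nat.add (Nat.mul x.a Z) x.b) (Nat.add (Nat.mul x.c Z) x.d)) (Nat.pow X 144))
   ((fun Z => pw (Nat.add (Nat.mul y.a Z) y.b) (Nat.add (Nat.mul y.c Z) y.d)) (Nat.pow X 12))
   (pw (Nat.add (Nat.mul z.a X) z.b) (Nat.add (Nat.mul z.c X) z.d)))
  (Nat.pow 2 W)

noncomputable def leaf2 (tp tn : Tab) (S : Nat) (x y z : Cell) (nu mu : Nat) : Bool :=
  leafW x y z tp tn nu mu
   (Nat.add 2 (Nat.log2 (Nat.mul (Nat.add S (Nat.mul mu 4288)) (Nat.mul x.bd (Nat.mul y.bd z.bd)))))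

noncomputable def leaf (tp tn : Tab) (S : Nat) (x y z : Cell) (m : Nat) : Bool :=
  Bool.rec
    (Bool.rec (leaf2 tp tn S x y z 1 (Nat.mul m 70368744177664)) (leaf2 tp tn S x y z 0 1) (Nat.beq m 4))
    (leaf2 tp tn S x y z 1 0) (Nat.beq m 3)

noncomputable def chk (tp tn : Tab) (S : Nat) (t : Tr) : Cell → Cell → Cell → Bool :=
  Tr.rec (fun _ _ L R x y z => and (L x.L y z) (R x.R y z))
    (fun _ _ L R x y z => and (L x y.L z) (R x y.R z))
    (fun _ _ L R x y z => and (L x y z.L) (R x y z.R))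
    (fun m x y z => leaf tp tn S x y z m) t

/-! ### Soundness -/

section ev
variable {R : Type*} [CommSemiring R]

def ev1 : List ℕ → (ℕ → R) → R
  | [], _ => 0
  | a :: l, f => (a : R) * f 0 + ev1 l (fun n => f (n + 1))
def ev2 (C : ℕ → R) : List (List ℕ) → (ℕ → R) → R
  | [], _ => 0
  | a :: l, f => ev1 a C * f 0 + ev2 C l (fun n => f (n + 1))
def ev3 (B C : ℕ → R) : Tab → (ℕ → R) → R
  | [], _ => 0
  | a :: l, f => ev2 C a B * f 0 + ev3 B C l (fun n => f (n + 1))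

lemma ev1_sum (l : List ℕ) (s : Finset ℕ) (t : ℕ → R) (T : ℕ → ℕ → R) :
    ev1 l (fun n => ∑ i ∈ s, T n i * t i) = ∑ i ∈ s, ev1 l (fun n => T n i) * t i := by
  induction l generalizing T with
  | nil => simp [ev1]
  | cons a l ih =>
    simp only [ev1, ih (fun n => T (n + 1)), Finset.mul_sum, ← Finset.sum_add_distrib]
    refine Finset.sum_congr rfl fun i _ => ?_; ring

lemma ev2_sumB (C : ℕ → R) (l : List (List ℕ)) (s : Finset ℕ) (t : ℕ → R) (T : ℕ → ℕ → R) :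
    ev2 C l (fun n => ∑ i ∈ s, T n i * t i) = ∑ i ∈ s, ev2 C l (fun n => T n i) * t i := by
  induction l generalizing T with
  | nil => simp [ev2]
  | cons a l ih =>
    simp only [ev2, ih (fun n => T (n + 1)), Finset.mul_sum, ← Finset.sum_add_distrib]
    refine Finset.sum_congr rfl fun i _ => ?_; ring

lemma ev2_sumC (B : ℕ → R) (l : List (List ℕ)) (s : Finset ℕ) (t : ℕ → R) (T : ℕ → ℕ → R) :
    ev2 (fun n => ∑ i ∈ s, T n i * t i) l B = ∑ i ∈ s, ev2 (fun n => T n i) l B * t i := by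
  induction l generalizing B with
  | nil => simp [ev2]
  | cons a l ih =>
    simp only [ev2, ih, ev1_sum, Finset.sum_mul, ← Finset.sum_add_distrib]
    refine Finset.sum_congr rfl fun i _ => ?_; ring

lemma ev3_sumA (B C : ℕ → R) (l : Tab) (s : Finset ℕ) (t : ℕ → R) (T : ℕ → ℕ → R) :
    ev3 B C l (fun n => ∑ i ∈ s, T n i * t i) = ∑ i ∈ s, ev3 B C l (fun n => T n i) * t i := by
  induction l generalizing T with
  | nil => simp [ev3]
  | cons a l ih =>
    simp only [ev3, ih (fun n => T (n + 1)), Finset.mul_sum, ← Finset.sum_add_distrib]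
    refine Finset.sum_congr rfl fun i _ => ?_; ring

lemma ev3_sumB (A C : ℕ → R) (l : Tab) (s : Finset ℕ) (t : ℕ → R) (T : ℕ → ℕ → R) :
    ev3 (fun n => ∑ i ∈ s, T n i * t i) C l A = ∑ i ∈ s, ev3 (fun n => T n i) C l A * t i := by
  induction l generalizing A with
  | nil => simp [ev3]
  | cons a l ih =>
    simp only [ev3, ih, ev2_sumB, Finset.sum_mul, ← Finset.sum_add_distrib]
    refine Finset.sum_congr rfl fun i _ => ?_; ring

lemma ev3_sumC (A B : ℕ → R) (l : Tab) (s : Finset ℕ) (t : ℕ → R) (T : ℕ → ℕ → R) :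
    ev3 B (fun n => ∑ i ∈ s, T n i * t i) l A = ∑ i ∈ s, ev3 B (fun n => T n i) l A * t i := by
  induction l generalizing A with
  | nil => simp [ev3]
  | cons a l ih =>
    simp only [ev3, ih, ev2_sumC, Finset.sum_mul, ← Finset.sum_add_distrib]
    refine Finset.sum_congr rfl fun i _ => ?_; ring

end ev

def tsum1 (l : List ℕ) : ℕ := ev1 l (fun _ => 1)
def tsum3 (l : Tab) : ℕ := ev3 (fun _ => 1) (fun _ => 1) l (fun _ => 1)

lemma ev1_mono (l : List ℕ) (f g : ℕ → ℕ) (h : ∀ n, f n ≤ g n) : ev1 l f ≤ ev1 l g := by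
  induction l generalizing f g with
  | nil => simp [ev1]
  | cons a l ih =>
    simp only [ev1]
    exact Nat.add_le_add (Nat.mul_le_mul_left _ (h 0)) (ih _ _ fun n => h (n + 1))

lemma ev2_mono (C C' : ℕ → ℕ) (hC : ∀ n, C n ≤ C' n) (l : List (List ℕ)) (f g : ℕ → ℕ)
    (h : ∀ n, f n ≤ g n) : ev2 C l f ≤ ev2 C' l g := by
  induction l generalizing f g with
  | nil => simp [ev2]
  | cons a l ih =>
    simp only [ev2]
    exact Nat.add_le_add (Nat.mul_le_mul (ev1_mono _ _ _ hC) (h 0)) (ih _ _ fun n => h (n + 1))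

lemma ev3_mono (B B' C C' : ℕ → ℕ) (hB : ∀ n, B n ≤ B' n) (hC : ∀ n, C n ≤ C' n) (l : Tab)
    (f g : ℕ → ℕ) (h : ∀ n, f n ≤ g n) : ev3 B C l f ≤ ev3 B' C' l g := by
  induction l generalizing f g with
  | nil => simp [ev3]
  | cons a l ih =>
    simp only [ev3]
    exact Nat.add_le_add (Nat.mul_le_mul (ev2_mono _ _ hC _ _ _ hB) (h 0))
      (ih _ _ fun n => h (n + 1))

lemma ev3_const (a b c : ℕ) (l : Tab) :
    ev3 (fun _ => b) (fun _ => c) l (fun _ => a) = tsum3 l * (a * (b * c)) := by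
  have h1 := ev3_sumA (R := ℕ) (fun _ => b) (fun _ => c) l {0} (fun _ => a) (fun _ _ => 1)
  have h2 := ev3_sumB (R := ℕ) (fun _ => 1) (fun _ => c) l {0} (fun _ => b) (fun _ _ => 1)
  have h3 := ev3_sumC (R := ℕ) (fun _ => 1) (fun _ => 1) l {0} (fun _ => c) (fun _ _ => 1)
  simp only [Finset.sum_singleton, one_mul] at h1 h2 h3
  rw [h1, h2, h3, tsum3]; ring

lemma ev3_cast (B C : ℕ → ℕ) (l : Tab) (A : ℕ → ℕ) :
    ((ev3 B C l A : ℕ) : ℝ) = ev3 (fun n => (B n : ℝ)) (fun n => (C n : ℝ)) l (fun n => (A n : ℝ)) := by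
  have e1 : ∀ (r : List ℕ) (C : ℕ → ℕ), ((ev1 r C : ℕ) : ℝ) = ev1 r (fun n => (C n : ℝ)) := by
    intro r; induction r with
    | nil => intro C; simp [ev1]
    | cons a r ih => intro C; simp [ev1, ih]
  have e2 : ∀ (r : List (List ℕ)) (B : ℕ → ℕ),
      ((ev2 C r B : ℕ) : ℝ) = ev2 (fun n => (C n : ℝ)) r (fun n => (B n : ℝ)) := by
    intro r; induction r with
    | nil => intro B; simp [ev2]
    | cons a r ih => intro B; simp [ev2, ih, e1]
  induction l generalizing A with
  | nil => simp [ev3]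
  | cons a r ih => simp [ev3, ih, e2]

/-- function of a list -/
def lf' (L : List ℕ) (n : ℕ) : ℕ := L.getD n 0

lemma hd_eq (L : List ℕ) : hd L = lf' L 0 := by cases L <;> simp [hd, lf']
lemma tl_eq (L : List ℕ) : (fun n => lf' L (n + 1)) = lf' (tl L) := by
  cases L <;> simp [tl, lf'] <;> rfl

lemma dot_eq (l L : List ℕ) : dot l L = ev1 l (lf' L) := by
  induction l generalizing L with
  | nil => rfl
  | cons a l ih =>
    have : dot (a :: l) L = a * hd L + dot l (tl L) := rfl
    rw [this, ih]; simp [ev1, tl_eq, hd_eq]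
lemma dot2_eq (PC : List ℕ) (l : List (List ℕ)) (L : List ℕ) :
    dot2 PC l L = ev2 (lf' PC) l (lf' L) := by
  induction l generalizing L with
  | nil => rfl
  | cons a l ih =>
    have : dot2 PC (a :: l) L = dot a PC * hd L + dot2 PC l (tl L) := rfl
    rw [this, ih]; simp [ev2, tl_eq, hd_eq, dot_eq]
lemma dot3_eq (PB PC : List ℕ) (l : Tab) (L : List ℕ) :
    dot3 PB PC l L = ev3 (lf' PB) (lf' PC) l (lf' L) := by
  induction l generalizing L with
  | nil => rfl
  | cons a l ih =>
    have : dot3 PB PC (a :: l) L = dot2 PC a PB * hd L + dot3 PB PC l (tl L) := rfl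
    rw [this, ih]; simp [ev3, tl_eq, hd_eq, dot2_eq]

/-- homogeneous powers -/
def hp {R : Type*} [CommSemiring R] (p q : R) (n : ℕ) : R := if n < 12 then p ^ n * q ^ (11 - n) else 0

lemma lf_pw (p q n : ℕ) : lf' (pw p q) n = hp p q n := by
  unfold hp
  split_ifs with h
  · interval_cases n <;> simp [lf', pw]
  · simp only [lf', pw]
    rw [List.getD_eq_default]; simp; omega

lemma hom_exists (a b c d : ℕ) (n e : ℕ) (hn : n ≤ e) : ∃ T : ℕ → ℕ, (∀ m, e < m → T m = 0) ∧
    (∀ u v : ℝ, (a * u + b * v) ^ n * (c * u + d * v) ^ (e - n) =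
      ∑ m ∈ Finset.range (e + 1), (T m : ℝ) * (u ^ m * v ^ (e - m))) := by
  have key : ∀ (a b e : ℕ) (f : ℝ → ℝ → ℝ), (∃ T : ℕ → ℕ, (∀ m, e < m → T m = 0) ∧
      ∀ u v : ℝ, f u v = ∑ m ∈ Finset.range (e + 1), (T m : ℝ) * (u ^ m * v ^ (e - m))) →
      (∃ T : ℕ → ℕ, (∀ m, e + 1 < m → T m = 0) ∧
      ∀ u v : ℝ, (a * u + b * v) * f u v =
        ∑ m ∈ Finset.range (e + 1 + 1), (T m : ℝ) * (u ^ m * v ^ (e + 1 - m))) := by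
    rintro a b e f ⟨T, hT, hf⟩
    refine ⟨fun m => b * T m + (if m = 0 then 0 else a * T (m - 1)), ?_, ?_⟩
    · intro m hm
      simp only [hT m (by omega), hT (m - 1) (by omega)]; simp
    · intro u v
      rw [hf]
      push_cast
      simp only [add_mul, Finset.sum_add_distrib]
      rw [add_comm]
      congr 1
      · rw [Finset.sum_range_succ _ (e + 1), hT (e + 1) (by omega), Finset.mul_sum]
        simp only [Nat.cast_zero, mul_zero, zero_mul, add_zero]
        refine Finset.sum_congr rfl fun m hm => ?_
        have : e + 1 - m = (e - m) + 1 := by have := Finset.mem_range.1 hm; omega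
        rw [this]; ring
      · rw [Finset.sum_range_succ' _ (e + 1), Finset.mul_sum]
        simp only [if_true, zero_mul, add_zero]
        refine Finset.sum_congr rfl fun m hm => ?_
        simp; ring
  have h0 : ∀ k, ∃ T : ℕ → ℕ, (∀ m, k < m → T m = 0) ∧
      ∀ u v : ℝ, (c * u + d * v) ^ k = ∑ m ∈ Finset.range (k + 1), (T m : ℝ) * (u ^ m * v ^ (k - m)) := by
    intro k
    induction k with
    | zero => exact ⟨fun m => if m = 0 then 1 else 0, fun m hm => by simp; omega, fun u v => by simp⟩
    | succ k ih =>
      obtain ⟨T, h1, h2⟩ := key c d k (fun u v => (c * u + d * v) ^ k) ih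
      exact ⟨T, h1, fun u v => by rw [← h2]; ring⟩
  have h1 : ∀ n k, ∃ T : ℕ → ℕ, (∀ m, n + k < m → T m = 0) ∧
      ∀ u v : ℝ, (a * u + b * v) ^ n * (c * u + d * v) ^ k =
        ∑ m ∈ Finset.range (n + k + 1), (T m : ℝ) * (u ^ m * v ^ (n + k - m)) := by
    intro n k
    induction n with
    | zero => simpa using h0 k
    | succ n ih =>
      obtain ⟨T, h1, h2⟩ := key a b (n + k) (fun u v => (a * u + b * v) ^ n * (c * u + d * v) ^ k) ih
      have e : n + 1 + k = n + k + 1 := by omega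
      rw [e]
      exact ⟨T, h1, fun u v => by rw [← h2]; ring⟩
  have := h1 n (e - n)
  rwa [Nat.add_sub_cancel' hn] at this

lemma nmax_eq (a b : ℕ) : nmax a b = max a b := by
  unfold nmax
  cases h : Nat.ble a b with
  | true => have := Nat.le_of_ble_eq_true h; simp [this]
  | false =>
    have : ¬ a ≤ b := fun h' => by rw [Nat.ble_eq_true_of_le h'] at h; cases h
    simp; omega

lemma hp_exists (x : Cell) : ∃ T : ℕ → ℕ → ℕ, (∀ n m, T n m ≤ x.bd) ∧
    (∀ u v : ℝ, ∀ n, hp (x.a * u + x.b * v) (x.c * u + x.d * v) n =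
      ∑ m ∈ Finset.range 12, (T n m : ℝ) * (u ^ m * v ^ (11 - m))) := by
  have : ∀ n, ∃ T : ℕ → ℕ, (∀ m, T m ≤ x.bd) ∧
    (∀ u v : ℝ, hp (x.a * u + x.b * v) (x.c * u + x.d * v) n =
      ∑ m ∈ Finset.range 12, (T m : ℝ) * (u ^ m * v ^ (11 - m))) := by
    intro n
    by_cases hn : n < 12
    · obtain ⟨T, h1, h2⟩ := hom_exists x.a x.b x.c x.d n 11 (by omega)
      refine ⟨T, ?_, fun u v => by simp only [hp, hn, if_true]; exact h2 u v⟩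
      intro m
      by_cases hm : m < 12
      · have e := h2 1 1
        simp only [one_pow, mul_one] at e
        have e' : (x.a + x.b) ^ n * (x.c + x.d) ^ (11 - n) = ∑ m ∈ Finset.range 12, T m := by
          exact_mod_cast e
        have h3 : T m ≤ ∑ m ∈ Finset.range 12, T m :=
          Finset.single_le_sum (f := T) (fun _ _ => Nat.zero_le _) (Finset.mem_range.2 hm)
        refine h3.trans ?_
        rw [← e']
        have hb : x.bd = (max (x.a + x.b) (x.c + x.d)) ^ n * (max (x.a + x.b) (x.c + x.d)) ^ (11 - n) := by
          rw [← pow_add]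
          have : n + (11 - n) = 11 := by omega
          rw [this, ← nmax_eq]; rfl
        rw [hb]
        exact Nat.mul_le_mul (Nat.pow_le_pow_left (le_max_left _ _) _)
          (Nat.pow_le_pow_left (le_max_right _ _) _)
      · rw [h1 m (by omega)]; exact Nat.zero_le _
    · exact ⟨fun _ => 0, fun _ => Nat.zero_le _, fun u v => by simp [hp, hn]⟩
  choose T h1 h2 using this
  exact ⟨T, h1, fun u v n => h2 n u v⟩

/-- value of a table on reals -/
noncomputable def val (t : Tab) (A A' B B' C C' : ℝ) : ℝ := ev3 (hp B B') (hp C C') t (hp A A')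

lemma val_exists (x y z : Cell) (t : Tab) : ∃ g : ℕ → ℕ → ℕ → ℕ,
    (∀ i j k, g i j k ≤ tsum3 t * (x.bd * (y.bd * z.bd))) ∧
    ∀ u1 v1 u2 v2 u3 v3 : ℝ, val t (x.a * u1 + x.b * v1) (x.c * u1 + x.d * v1)
      (y.a * u2 + y.b * v2) (y.c * u2 + y.d * v2) (z.a * u3 + z.b * v3) (z.c * u3 + z.d * v3) =
      ∑ i ∈ Finset.range 12, ∑ j ∈ Finset.range 12, ∑ k ∈ Finset.range 12,
        (g i j k : ℝ) * ((u1 ^ i * v1 ^ (11 - i)) * (u2 ^ j * v2 ^ (11 - j)) * (u3 ^ k * v3 ^ (11 - k))) := by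
  obtain ⟨T1, b1, e1⟩ := hp_exists x
  obtain ⟨T2, b2, e2⟩ := hp_exists y
  obtain ⟨T3, b3, e3⟩ := hp_exists z
  refine ⟨fun i j k => ev3 (fun n => T2 n j) (fun n => T3 n k) t (fun n => T1 n i), ?_, ?_⟩
  · intro i j k
    rw [← ev3_const]
    exact ev3_mono _ _ _ _ (fun n => b2 n j) (fun n => b3 n k) _ _ _ (fun n => b1 n i)
  · intro u1 v1 u2 v2 u3 v3
    unfold val
    have f1 := funext (e1 u1 v1)
    have f2 := funext (e2 u2 v2)
    have f3 := funext (e3 u3 v3)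
    rw [f1, f2, f3, ev3_sumA]
    refine Finset.sum_congr rfl fun i _ => ?_
    rw [ev3_sumB, Finset.sum_mul]
    refine Finset.sum_congr rfl fun j _ => ?_
    rw [ev3_sumC, Finset.sum_mul, Finset.sum_mul]
    refine Finset.sum_congr rfl fun k _ => ?_
    rw [ev3_cast]; ring

lemma digits (W : ℕ) (hW : 0 < W) : ∀ (M D : ℕ) (h : ℕ → ℤ), (∀ t, |h t| < 2 ^ (W - 1)) →
    ((D : ℤ) = ∑ t ∈ Finset.range M, h t * (2 ^ W) ^ t) →
    D &&& (2 ^ (W - 1) * ∑ t ∈ Finset.range M, (2 ^ W) ^ t) = 0 → ∀ t < M, 0 ≤ h t := by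
  intro M
  induction M with
  | zero => intro D h _ _ _ t ht; omega
  | succ M ih =>
    intro D h hb hD hm
    have hX : (2 : ℕ) ^ W = 2 ^ (W - 1) * 2 := by rw [← pow_succ]; congr 1; omega
    have hXz : (2 : ℤ) ^ W = 2 ^ (W - 1) * 2 := by rw [← pow_succ]; congr 1; omega
    set X : ℕ := 2 ^ W with hXd
    have hmask : 2 ^ (W - 1) * ∑ t ∈ Finset.range (M + 1), X ^ t =
        2 ^ (W - 1) + X * (2 ^ (W - 1) * ∑ t ∈ Finset.range M, X ^ t) := by
      rw [Finset.sum_range_succ', mul_add, Finset.mul_sum, Finset.mul_sum, Finset.mul_sum]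
      rw [add_comm]; simp only [pow_zero, mul_one]; congr 1
      refine Finset.sum_congr rfl fun t _ => ?_; ring
    have hD' : (D : ℤ) = h 0 + 2 ^ W * ∑ t ∈ Finset.range M, h (t + 1) * (2 ^ W) ^ t := by
      rw [hD, Finset.sum_range_succ', Finset.mul_sum, add_comm]; simp only [pow_zero, mul_one]; congr 1
      refine Finset.sum_congr rfl fun t _ => ?_; ring
    have hlt : 2 ^ (W - 1) < X := by rw [hX]; have : 0 < 2 ^ (W - 1) := by positivity
                                     omega
    -- low digit
    have hlow : D % X < 2 ^ (W - 1) := by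
      have h1 : (D &&& (2 ^ (W - 1) * ∑ t ∈ Finset.range (M + 1), X ^ t)) % X = 0 := by rw [hm]; simp
      rw [hmask, hXd, Nat.and_mod_two_pow, ← hXd, Nat.add_mul_mod_self_left, Nat.mod_eq_of_lt hlt] at h1
      by_contra hc
      push Not at hc
      have hbit : (D % X).testBit (W - 1) = true := by
        have hlt2 : D % X < 2 ^ (W - 1) * 2 := by rw [← hX]; exact Nat.mod_lt _ (by positivity)
        rw [Nat.testBit_eq_decide_div_mod_eq]
        have : D % X / 2 ^ (W - 1) = 1 := by
          apply Nat.div_eq_of_lt_le <;> omega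
        rw [this]; rfl
      have h2 : (D % X &&& 2 ^ (W - 1)).testBit (W - 1) = true := by
        rw [Nat.testBit_and, hbit, Nat.testBit_two_pow_self]; rfl
      rw [h1] at h2; simp at h2
    have hq : D / X &&& (2 ^ (W - 1) * ∑ t ∈ Finset.range M, X ^ t) = 0 := by
      have h1 : (D &&& (2 ^ (W - 1) * ∑ t ∈ Finset.range (M + 1), X ^ t)) / X = 0 := by rw [hm]; simp
      rw [hmask, hXd, Nat.and_div_two_pow, ← hXd, Nat.add_mul_div_left _ _ (by positivity), Nat.div_eq_of_lt hlt,
        zero_add] at h1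
      exact h1
    have hdm : (D : ℤ) = (D % X : ℕ) + 2 ^ W * (D / X : ℕ) := by
      have := Nat.mod_add_div D X
      have h2 : ((D % X + X * (D / X) : ℕ) : ℤ) = D := by rw [this]
      rw [← h2, hXd]; push_cast; ring
    have h0 := hb 0
    rw [abs_lt] at h0
    set q1 : ℤ := ∑ t ∈ Finset.range M, h (t + 1) * (2 ^ W) ^ t
    have hl : ((D % X : ℕ) : ℤ) < 2 ^ (W - 1) := by exact_mod_cast hlow
    have hl0 : (0 : ℤ) ≤ ((D % X : ℕ) : ℤ) := Int.natCast_nonneg _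
    have hpos : (0 : ℤ) < 2 ^ W := by positivity
    have hqq : q1 = ((D / X : ℕ) : ℤ) := by
      have e : 2 ^ W * (q1 - ((D / X : ℕ) : ℤ)) = (D % X : ℕ) - h 0 := by linarith
      have a1 : 2 ^ W * (q1 - ((D / X : ℕ) : ℤ)) < 2 ^ W * 1 := by linarith
      have a2 : 2 ^ W * (-1) < 2 ^ W * (q1 - ((D / X : ℕ) : ℤ)) := by linarith
      have b1 := lt_of_mul_lt_mul_left a1 hpos.le
      have b2 := lt_of_mul_lt_mul_left a2 hpos.le
      omega
    have hh0 : 0 ≤ h 0 := by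
      rw [hqq] at hD'; linarith
    intro t ht
    rcases t with _ | t
    · exact hh0
    · exact ih (D / X) (fun t => h (t + 1)) (fun t => hb (t + 1)) hqq.symm hq t (by omega)

lemma sum_flat (f : ℕ → ℤ) (n m : ℕ) :
    ∑ t ∈ Finset.range (n * m), f t = ∑ i ∈ Finset.range n, ∑ j ∈ Finset.range m, f (i * m + j) := by
  induction n with
  | zero => simp
  | succ n ih => rw [Nat.succ_mul, Finset.sum_range_add, ih, Finset.sum_range_succ]

set_option exponentiation.threshold 2000 in
lemma rep_eq (W : ℕ) (hW : 2 ≤ W) : rep W = ∑ t ∈ Finset.range 1728, (2 ^ W) ^ t := by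
  have h2 : 2 ≤ 2 ^ W := by
    calc 2 = 2 ^ 1 := rfl
      _ ≤ 2 ^ W := Nat.pow_le_pow_right (by norm_num) (by omega)
  rw [Nat.geomSum_eq h2]; rfl

lemma isNeg_sound (W : ℕ) (hW : 2 ≤ W) (g g' : ℕ → ℕ → ℕ → ℕ) (p n : ℕ)
    (hg : ∀ i j k, g i j k < 2 ^ (W - 1)) (hg' : ∀ i j k, g' i j k < 2 ^ (W - 1))
    (hp : (p : ℤ) = ∑ i ∈ Finset.range 12, ∑ j ∈ Finset.range 12, ∑ k ∈ Finset.range 12,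
        (g i j k : ℤ) * (2 ^ W) ^ (i * 144 + (j * 12 + k)))
    (hn : (n : ℤ) = ∑ i ∈ Finset.range 12, ∑ j ∈ Finset.range 12, ∑ k ∈ Finset.range 12,
        (g' i j k : ℤ) * (2 ^ W) ^ (i * 144 + (j * 12 + k)))
    (h : isNeg W p n = true) : ∀ i < 12, ∀ j < 12, ∀ k < 12, g i j k ≤ g' i j k := by
  unfold isNeg at h
  rw [Bool.and_eq_true] at h
  obtain ⟨h1, h2⟩ := h
  have h1' : p ≤ n := Nat.le_of_ble_eq_true h1
  have h2' : (n - p) &&& (2 ^ (W - 1) * ∑ t ∈ Finset.range 1728, (2 ^ W) ^ t) = 0 := by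
    rw [← rep_eq W hW]; exact Nat.eq_of_beq_eq_true h2
  have key := digits W (by omega) 1728 (n - p)
    (fun t => (g' (t / 144) (t % 144 / 12) (t % 12) : ℤ) - g (t / 144) (t % 144 / 12) (t % 12))
    (fun t => by
      have a := hg (t / 144) (t % 144 / 12) (t % 12)
      have b := hg' (t / 144) (t % 144 / 12) (t % 12)
      have a' : ((g (t / 144) (t % 144 / 12) (t % 12) : ℕ) : ℤ) < 2 ^ (W - 1) := by exact_mod_cast a
      have b' : ((g' (t / 144) (t % 144 / 12) (t % 12) : ℕ) : ℤ) < 2 ^ (W - 1) := by exact_mod_cast b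
      rw [abs_lt]; constructor <;> linarith [Int.natCast_nonneg (g (t / 144) (t % 144 / 12) (t % 12)),
        Int.natCast_nonneg (g' (t / 144) (t % 144 / 12) (t % 12))])
    (by
      rw [Nat.cast_sub h1', hp, hn, show 1728 = 12 * (12 * 12) by norm_num, sum_flat, ← Finset.sum_sub_distrib]
      refine Finset.sum_congr rfl fun i hi => ?_
      rw [sum_flat, ← Finset.sum_sub_distrib]
      refine Finset.sum_congr rfl fun j hj => ?_
      rw [← Finset.sum_sub_distrib]
      refine Finset.sum_congr rfl fun k hk => ?_
      have hi := Finset.mem_range.1 hi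
      have hj := Finset.mem_range.1 hj
      have hk := Finset.mem_range.1 hk
      have e1 : (i * (12 * 12) + (j * 12 + k)) / 144 = i := by omega
      have e2 : (i * (12 * 12) + (j * 12 + k)) % 144 / 12 = j := by omega
      have e3 : (i * (12 * 12) + (j * 12 + k)) % 12 = k := by omega
      rw [e1, e2, e3]; ring)
    h2'
  intro i hi j hj k hk
  have := key (i * 144 + (j * 12 + k)) (by omega)
  have e1 : (i * 144 + (j * 12 + k)) / 144 = i := by omega
  have e2 : (i * 144 + (j * 12 + k)) % 144 / 12 = j := by omega
  have e3 : (i * 144 + (j * 12 + k)) % 12 = k := by omega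
  simp only [e1, e2, e3] at this
  omega


lemma hp_cast (p q n : ℕ) : ((hp p q n : ℕ) : ℝ) = hp (p : ℝ) (q : ℝ) n := by
  unfold hp; split_ifs <;> push_cast <;> rfl

lemma dot3_val (t : Tab) (a a' b b' c c' : ℕ) :
    ((dot3 (pw b b') (pw c c') t (pw a a') : ℕ) : ℝ) = val t a a' b b' c c' := by
  rw [dot3_eq, ev3_cast]; unfold val; simp only [lf_pw, hp_cast]

lemma leafW_sound (x y z : Cell) (tp tn : Tab) (nu mu W : ℕ) (hW : 2 ≤ W)
    (hb1 : (nu * tsum3 tp + mu * tsum3 qp) * (x.bd * (y.bd * z.bd)) < 2 ^ (W - 1))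
    (hb2 : (nu * tsum3 tn + mu * tsum3 qn) * (x.bd * (y.bd * z.bd)) < 2 ^ (W - 1))
    (h : leafW x y z tp tn nu mu W = true) (u1 v1 u2 v2 u3 v3 : ℝ)
    (hu1 : 0 ≤ u1) (hv1 : 0 ≤ v1) (hu2 : 0 ≤ u2) (hv2 : 0 ≤ v2) (hu3 : 0 ≤ u3) (hv3 : 0 ≤ v3) :
    nu * val tp (x.a * u1 + x.b * v1) (x.c * u1 + x.d * v1)
      (y.a * u2 + y.b * v2) (y.c * u2 + y.d * v2) (z.a * u3 + z.b * v3) (z.c * u3 + z.d * v3)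
    + mu * val qp (x.a * u1 + x.b * v1) (x.c * u1 + x.d * v1)
      (y.a * u2 + y.b * v2) (y.c * u2 + y.d * v2) (z.a * u3 + z.b * v3) (z.c * u3 + z.d * v3) ≤
    nu * val tn (x.a * u1 + x.b * v1) (x.c * u1 + x.d * v1)
      (y.a * u2 + y.b * v2) (y.c * u2 + y.d * v2) (z.a * u3 + z.b * v3) (z.c * u3 + z.d * v3)
    + mu * val qn (x.a * u1 + x.b * v1) (x.c * u1 + x.d * v1)
      (y.a * u2 + y.b * v2) (y.c * u2 + y.d * v2) (z.a * u3 + z.b * v3) (z.c * u3 + z.d * v3) := by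
  have comb : ∀ t q : Tab, (nu * tsum3 t + mu * tsum3 q) * (x.bd * (y.bd * z.bd)) < 2 ^ (W - 1) →
      ∃ g : ℕ → ℕ → ℕ → ℕ, (∀ i j k, g i j k < 2 ^ (W - 1)) ∧
      ∀ u1 v1 u2 v2 u3 v3 : ℝ, nu * val t (x.a * u1 + x.b * v1) (x.c * u1 + x.d * v1)
      (y.a * u2 + y.b * v2) (y.c * u2 + y.d * v2) (z.a * u3 + z.b * v3) (z.c * u3 + z.d * v3)
      + mu * val q (x.a * u1 + x.b * v1) (x.c * u1 + x.d * v1)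
      (y.a * u2 + y.b * v2) (y.c * u2 + y.d * v2) (z.a * u3 + z.b * v3) (z.c * u3 + z.d * v3) =
      ∑ i ∈ Finset.range 12, ∑ j ∈ Finset.range 12, ∑ k ∈ Finset.range 12,
        (g i j k : ℝ) * ((u1 ^ i * v1 ^ (11 - i)) * (u2 ^ j * v2 ^ (11 - j)) * (u3 ^ k * v3 ^ (11 - k))) := by
    intro t q hb
    obtain ⟨g1, a1, e1⟩ := val_exists x y z t
    obtain ⟨g2, a2, e2⟩ := val_exists x y z q
    refine ⟨fun i j k => nu * g1 i j k + mu * g2 i j k, fun i j k => ?_, ?_⟩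
    · refine lt_of_le_of_lt ?_ hb
      calc nu * g1 i j k + mu * g2 i j k ≤ nu * (tsum3 t * (x.bd * (y.bd * z.bd))) +
            mu * (tsum3 q * (x.bd * (y.bd * z.bd))) :=
            Nat.add_le_add (Nat.mul_le_mul_left _ (a1 i j k)) (Nat.mul_le_mul_left _ (a2 i j k))
        _ = _ := by ring
    · intro u1 v1 u2 v2 u3 v3
      rw [e1, e2]
      simp only [Finset.mul_sum, ← Finset.sum_add_distrib]
      refine Finset.sum_congr rfl fun i _ => Finset.sum_congr rfl fun j _ =>
        Finset.sum_congr rfl fun k _ => ?_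
      push_cast; ring
  obtain ⟨g, gb, ge⟩ := comb tp qp hb1
  obtain ⟨g', gb', ge'⟩ := comb tn qn hb2
  have num : ∀ (t q : Tab) (g : ℕ → ℕ → ℕ → ℕ), (∀ u1 v1 u2 v2 u3 v3 : ℝ, nu * val t (x.a * u1 + x.b * v1) (x.c * u1 + x.d * v1)
      (y.a * u2 + y.b * v2) (y.c * u2 + y.d * v2) (z.a * u3 + z.b * v3) (z.c * u3 + z.d * v3)
      + mu * val q (x.a * u1 + x.b * v1) (x.c * u1 + x.d * v1)
      (y.a * u2 + y.b * v2) (y.c * u2 + y.d * v2) (z.a * u3 + z.b * v3) (z.c * u3 + z.d * v3) =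
      ∑ i ∈ Finset.range 12, ∑ j ∈ Finset.range 12, ∑ k ∈ Finset.range 12,
        (g i j k : ℝ) * ((u1 ^ i * v1 ^ (11 - i)) * (u2 ^ j * v2 ^ (11 - j)) * (u3 ^ k * v3 ^ (11 - k)))) →
      ((nu * dot3 (pw (y.a * (2 ^ W) ^ 12 + y.b) (y.c * (2 ^ W) ^ 12 + y.d))
        (pw (z.a * 2 ^ W + z.b) (z.c * 2 ^ W + z.d)) t
        (pw (x.a * (2 ^ W) ^ 144 + x.b) (x.c * (2 ^ W) ^ 144 + x.d)) +
       mu * dot3 (pw (y.a * (2 ^ W) ^ 12 + y.b) (y.c * (2 ^ W) ^ 12 + y.d))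
        (pw (z.a * 2 ^ W + z.b) (z.c * 2 ^ W + z.d)) q
        (pw (x.a * (2 ^ W) ^ 144 + x.b) (x.c * (2 ^ W) ^ 144 + x.d)) : ℕ) : ℤ) =
      ∑ i ∈ Finset.range 12, ∑ j ∈ Finset.range 12, ∑ k ∈ Finset.range 12,
        (g i j k : ℤ) * (2 ^ W) ^ (i * 144 + (j * 12 + k)) := by
    intro t q g hg
    have := hg (((2 : ℝ) ^ W) ^ 144) 1 (((2 : ℝ) ^ W) ^ 12) 1 ((2 : ℝ) ^ W) 1
    have e : ((nu * dot3 (pw (y.a * (2 ^ W) ^ 12 + y.b) (y.c * (2 ^ W) ^ 12 + y.d))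
        (pw (z.a * 2 ^ W + z.b) (z.c * 2 ^ W + z.d)) t
        (pw (x.a * (2 ^ W) ^ 144 + x.b) (x.c * (2 ^ W) ^ 144 + x.d)) +
       mu * dot3 (pw (y.a * (2 ^ W) ^ 12 + y.b) (y.c * (2 ^ W) ^ 12 + y.d))
        (pw (z.a * 2 ^ W + z.b) (z.c * 2 ^ W + z.d)) q
        (pw (x.a * (2 ^ W) ^ 144 + x.b) (x.c * (2 ^ W) ^ 144 + x.d)) : ℕ) : ℝ) =
      ((∑ i ∈ Finset.range 12, ∑ j ∈ Finset.range 12, ∑ k ∈ Finset.range 12,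
        (g i j k : ℤ) * (2 ^ W) ^ (i * 144 + (j * 12 + k)) : ℤ) : ℝ) := by
      rw [Nat.cast_add, Nat.cast_mul, Nat.cast_mul, dot3_val, dot3_val]
      simp only [Nat.cast_add, Nat.cast_mul, Nat.cast_pow, Nat.cast_ofNat]
      simp only [mul_one] at this
      rw [this]
      simp only [Int.cast_sum, Int.cast_mul, Int.cast_natCast, Int.cast_pow, Int.cast_ofNat]
      refine Finset.sum_congr rfl fun i _ => Finset.sum_congr rfl fun j _ =>
        Finset.sum_congr rfl fun k _ => ?_
      rw [one_pow, one_pow, one_pow, mul_one, mul_one, mul_one, ← pow_mul (_ ^ W), ← pow_mul (_ ^ W), ← pow_add, ← pow_add]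
      congr 2; ring
    exact_mod_cast e
  have key := isNeg_sound W hW g g' _ _ gb gb' (num tp qp g ge) (num tn qn g' ge') h
  rw [ge, ge']
  refine Finset.sum_le_sum fun i hi => Finset.sum_le_sum fun j hj => Finset.sum_le_sum fun k hk => ?_
  have := key i (Finset.mem_range.1 hi) j (Finset.mem_range.1 hj) k (Finset.mem_range.1 hk)
  have h2 : (g i j k : ℝ) ≤ g' i j k := by exact_mod_cast this
  exact mul_le_mul_of_nonneg_right h2 (by positivity)

lemma leaf2_sound (x y z : Cell) (tp tn : Tab) (S nu mu : ℕ) (hnu : nu ≤ 1)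
    (hS1 : tsum3 tp ≤ S) (hS2 : tsum3 tn ≤ S)
    (h : leaf2 tp tn S x y z nu mu = true) (u1 v1 u2 v2 u3 v3 : ℝ)
    (hu1 : 0 ≤ u1) (hv1 : 0 ≤ v1) (hu2 : 0 ≤ u2) (hv2 : 0 ≤ v2) (hu3 : 0 ≤ u3) (hv3 : 0 ≤ v3) :
    nu * val tp (x.a * u1 + x.b * v1) (x.c * u1 + x.d * v1)
      (y.a * u2 + y.b * v2) (y.c * u2 + y.d * v2) (z.a * u3 + z.b * v3) (z.c * u3 + z.d * v3)
    + mu * val qp (x.a * u1 + x.b * v1) (x.c * u1 + x.d * v1)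
      (y.a * u2 + y.b * v2) (y.c * u2 + y.d * v2) (z.a * u3 + z.b * v3) (z.c * u3 + z.d * v3) ≤
    nu * val tn (x.a * u1 + x.b * v1) (x.c * u1 + x.d * v1)
      (y.a * u2 + y.b * v2) (y.c * u2 + y.d * v2) (z.a * u3 + z.b * v3) (z.c * u3 + z.d * v3)
    + mu * val qn (x.a * u1 + x.b * v1) (x.c * u1 + x.d * v1)
      (y.a * u2 + y.b * v2) (y.c * u2 + y.d * v2) (z.a * u3 + z.b * v3) (z.c * u3 + z.d * v3) := by
  have hq1 : tsum3 qp ≤ 4288 := by decide +kernel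
  have hq2 : tsum3 qn ≤ 4288 := by decide +kernel
  have hlog : (S + mu * 4288) * (x.bd * (y.bd * z.bd)) <
      2 ^ (2 + Nat.log2 ((S + mu * 4288) * (x.bd * (y.bd * z.bd))) - 1) := by
    have := Nat.lt_log2_self (n := (S + mu * 4288) * (x.bd * (y.bd * z.bd)))
    have e : 2 + Nat.log2 ((S + mu * 4288) * (x.bd * (y.bd * z.bd))) - 1 =
      Nat.log2 ((S + mu * 4288) * (x.bd * (y.bd * z.bd))) + 1 := by omega
    rwa [e]
  refine leafW_sound x y z tp tn nu mu _ (Nat.le_add_right _ _) ?_ ?_ h u1 v1 u2 v2 u3 v3 hu1 hv1 hu2 hv2 hu3 hv3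
  · refine lt_of_le_of_lt (Nat.mul_le_mul_right _ (Nat.add_le_add ?_ (Nat.mul_le_mul_left _ hq1))) hlog
    calc nu * tsum3 tp ≤ 1 * tsum3 tp := Nat.mul_le_mul_right _ hnu
      _ ≤ S := by omega
  · refine lt_of_le_of_lt (Nat.mul_le_mul_right _ (Nat.add_le_add ?_ (Nat.mul_le_mul_left _ hq2))) hlog
    calc nu * tsum3 tn ≤ 1 * tsum3 tn := Nat.mul_le_mul_right _ hnu
      _ ≤ S := by omega

/-- leaves use no `Q` -/
def Tr.pure : Tr → Bool
  | .n0 l r => l.pure && r.pure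
  | .n1 l r => l.pure && r.pure
  | .n2 l r => l.pure && r.pure
  | .lf m => m == 3

lemma chk_sound (tp tn : Tab) (S : ℕ) (hS1 : tsum3 tp ≤ S) (hS2 : tsum3 tn ≤ S)
    (A A' B B' C C' : ℝ) (t : Tr)
    (hQ : t.pure = true ∨ val qn A A' B B' C C' < val qp A A' B B' C C') :
    ∀ (x y z : Cell), chk tp tn S t x y z = true → ∀ u1 v1 u2 v2 u3 v3 : ℝ,
    0 ≤ u1 → 0 ≤ v1 → 0 ≤ u2 → 0 ≤ v2 → 0 ≤ u3 → 0 ≤ v3 →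
    A = x.a * u1 + x.b * v1 → A' = x.c * u1 + x.d * v1 →
    B = y.a * u2 + y.b * v2 → B' = y.c * u2 + y.d * v2 →
    C = z.a * u3 + z.b * v3 → C' = z.c * u3 + z.d * v3 →
    val tp A A' B B' C C' ≤ val tn A A' B B' C C' := by
  have cL : ∀ (x : Cell) (A A' u v : ℝ), u ≤ v → A = x.a * u + x.b * v → A' = x.c * u + x.d * v →
      A = x.L.a * u + x.L.b * ((v - u) / 2) ∧ A' = x.L.c * u + x.L.d * ((v - u) / 2) := by
    intro x A A' u v _ h1 h2
    have e1 : x.L.a = x.a + x.b := rfl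
    have e2 : x.L.b = 2 * x.b := rfl
    have e3 : x.L.c = x.c + x.d := rfl
    have e4 : x.L.d = 2 * x.d := rfl
    rw [e1, e2, e3, e4, h1, h2]; push_cast; constructor <;> ring
  have cR : ∀ (x : Cell) (A A' u v : ℝ), A = x.a * u + x.b * v → A' = x.c * u + x.d * v →
      A = x.R.a * ((u - v) / 2) + x.R.b * v ∧ A' = x.R.c * ((u - v) / 2) + x.R.d * v := by
    intro x A A' u v h1 h2
    have e1 : x.R.a = 2 * x.a := rfl
    have e2 : x.R.b = x.a + x.b := rfl
    have e3 : x.R.c = 2 * x.c := rfl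
    have e4 : x.R.d = x.c + x.d := rfl
    rw [e1, e2, e3, e4, h1, h2]; push_cast; constructor <;> ring
  induction t with
  | n0 l r ihl ihr =>
    intro x y z h u1 v1 u2 v2 u3 v3 hu1 hv1 hu2 hv2 hu3 hv3 a1 a2 a3 a4 a5 a6
    have h' : (chk tp tn S l x.L y z && chk tp tn S r x.R y z) = true := h
    rw [Bool.and_eq_true] at h'
    simp only [Tr.pure, Bool.and_eq_true] at hQ
    rcases le_total u1 v1 with hc | hc
    · obtain ⟨b1, b2⟩ := cL x A A' u1 v1 hc a1 a2
      exact ihl (hQ.imp_left And.left) _ _ _ h'.1 _ _ _ _ _ _ hu1 (by linarith) hu2 hv2 hu3 hv3 b1 b2 a3 a4 a5 a6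
    · obtain ⟨b1, b2⟩ := cR x A A' u1 v1 a1 a2
      exact ihr (hQ.imp_left And.right) _ _ _ h'.2 _ _ _ _ _ _ (by linarith) hv1 hu2 hv2 hu3 hv3 b1 b2 a3 a4 a5 a6
  | n1 l r ihl ihr =>
    intro x y z h u1 v1 u2 v2 u3 v3 hu1 hv1 hu2 hv2 hu3 hv3 a1 a2 a3 a4 a5 a6
    have h' : (chk tp tn S l x y.L z && chk tp tn S r x y.R z) = true := h
    rw [Bool.and_eq_true] at h'
    simp only [Tr.pure, Bool.and_eq_true] at hQ
    rcases le_total u2 v2 with hc | hc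
    · obtain ⟨b1, b2⟩ := cL y B B' u2 v2 hc a3 a4
      exact ihl (hQ.imp_left And.left) _ _ _ h'.1 _ _ _ _ _ _ hu1 hv1 hu2 (by linarith) hu3 hv3 a1 a2 b1 b2 a5 a6
    · obtain ⟨b1, b2⟩ := cR y B B' u2 v2 a3 a4
      exact ihr (hQ.imp_left And.right) _ _ _ h'.2 _ _ _ _ _ _ hu1 hv1 (by linarith) hv2 hu3 hv3 a1 a2 b1 b2 a5 a6
  | n2 l r ihl ihr =>
    intro x y z h u1 v1 u2 v2 u3 v3 hu1 hv1 hu2 hv2 hu3 hv3 a1 a2 a3 a4 a5 a6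
    have h' : (chk tp tn S l x y z.L && chk tp tn S r x y z.R) = true := h
    rw [Bool.and_eq_true] at h'
    simp only [Tr.pure, Bool.and_eq_true] at hQ
    rcases le_total u3 v3 with hc | hc
    · obtain ⟨b1, b2⟩ := cL z C C' u3 v3 hc a5 a6
      exact ihl (hQ.imp_left And.left) _ _ _ h'.1 _ _ _ _ _ _ hu1 hv1 hu2 hv2 hu3 (by linarith) a1 a2 a3 a4 b1 b2
    · obtain ⟨b1, b2⟩ := cR z C C' u3 v3 a5 a6
      exact ihr (hQ.imp_left And.right) _ _ _ h'.2 _ _ _ _ _ _ hu1 hv1 hu2 hv2 (by linarith) hv3 a1 a2 a3 a4 b1 b2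
  | lf m =>
    intro x y z h u1 v1 u2 v2 u3 v3 hu1 hv1 hu2 hv2 hu3 hv3 a1 a2 a3 a4 a5 a6
    have h' : leaf tp tn S x y z m = true := h
    have fin : ∀ nu mu : ℕ, nu ≤ 1 → leaf2 tp tn S x y z nu mu = true →
        nu * val tp A A' B B' C C' + mu * val qp A A' B B' C C' ≤
        nu * val tn A A' B B' C C' + mu * val qn A A' B B' C C' := by
      intro nu mu hnu hl
      rw [a1, a2, a3, a4, a5, a6]
      exact leaf2_sound x y z tp tn S nu mu hnu hS1 hS2 hl u1 v1 u2 v2 u3 v3 hu1 hv1 hu2 hv2 hu3 hv3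
    unfold leaf at h'
    cases e3 : Nat.beq m 3 with
    | true =>
      rw [e3] at h'
      have := fin 1 0 le_rfl h'
      simpa using this
    | false =>
      rw [e3] at h'
      have hQ' : val qn A A' B B' C C' < val qp A A' B B' C C' := by
        rcases hQ with hQ | hQ
        · simp only [Tr.pure] at hQ
          rw [beq_iff_eq] at hQ; subst hQ; simp at e3
        · exact hQ
      cases e4 : Nat.beq m 4 with
      | true =>
        rw [e4] at h'
        have := fin 0 1 (by norm_num) h'
        simp at this; linarith
      | false =>
        rw [e4] at h'
        have := fin 1 _ le_rfl h'
        rw [Nat.cast_one, one_mul, one_mul] at this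
        have h2 := mul_le_mul_of_nonneg_left hQ'.le (Nat.cast_nonneg (α := ℝ) (Nat.mul m 70368744177664))
        linarith

def tPp : Tab := [[[18210381831126823750]],
[[0],
[0, 0]],
[[245362146337402582752],
[119280309935086161936, 119280309935086161936],
[245362146337402582752, 119280309935086161936, 245362146337402582752]],
[[0],
[0, 0],
[0, 0, 0],
[0, 0, 0, 0]],
[[1262274129596471795712],
[3780168999582095811072, 3780168999582095811072],
[3397489870975029345024, 7065376605508510407168, 3397489870975029345024],
[3780168999582095811072, 7065376605508510407168, 7065376605508510407168, 3780168999582095811072],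
[1262274129596471795712, 3780168999582095811072, 3397489870975029345024, 3780168999582095811072, 1262274129596471795712]],
[[0],
[0, 0],
[0, 0, 0],
[0, 0, 0, 0],
[0, 0, 0, 0, 0],
[0, 0, 0, 0, 0, 0]],
[[5905500046606709673984],
[26728360245355561648128, 26728360245355561648128],
[28905679381943600345088, 41734179100954404163584, 28905679381943600345088],
[73833905636462952124416, 159861507336020514373632, 159861507336020514373632, 73833905636462952124416],
[28905679381943600345088, 159861507336020514373632, 476398464945163311476736, 159861507336020514373632, 28905679381943600345088],
[26728360245355561648128, 41734179100954404163584, 159861507336020514373632, 159861507336020514373632, 41734179100954404163584, 26728360245355561648128],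
[5905500046606709673984, 26728360245355561648128, 28905679381943600345088, 73833905636462952124416, 28905679381943600345088, 26728360245355561648128, 5905500046606709673984]],
[[0],
[0, 0],
[0, 0, 0],
[0, 0, 0, 0],
[0, 0, 0, 0, 0],
[0, 0, 0, 0, 0, 0],
[0, 0, 0, 0, 0, 0, 0],
[0, 0, 0, 0, 0, 0, 0, 0]],
[[3012131315265045921792],
[24099511627696489168896, 24099511627696489168896],
[849237323760572497920, 0, 849237323760572497920],
[169972706219768791105536, 50467445234768839901184, 50467445234768839901184, 169972706219768791105536],
[435413964924448807845888, 526893772567430330449920, 1602958774155962688405504, 526893772567430330449920, 435413964924448807845888],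
[169972706219768791105536, 526893772567430330449920, 3389835053695228666380288, 3389835053695228666380288, 526893772567430330449920, 169972706219768791105536],
[849237323760572497920, 50467445234768839901184, 1602958774155962688405504, 3389835053695228666380288, 1602958774155962688405504, 50467445234768839901184, 849237323760572497920],
[24099511627696489168896, 0, 50467445234768839901184, 526893772567430330449920, 526893772567430330449920, 50467445234768839901184, 0, 24099511627696489168896],
[3012131315265045921792, 24099511627696489168896, 849237323760572497920, 169972706219768791105536, 435413964924448807845888, 169972706219768791105536, 849237323760572497920, 24099511627696489168896, 3012131315265045921792]],
[[0],
[0, 0],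
[3877997840140783583232, 67157128149708061016064, 3877997840140783583232],
[0, 16328532988992653623296, 16328532988992653623296, 0],
[0, 0, 0, 0, 0],
[0, 0, 0, 0, 0, 0],
[0, 0, 0, 0, 0, 0, 0],
[3877997840140783583232, 16328532988992653623296, 0, 0, 0, 0, 16328532988992653623296, 3877997840140783583232],
[0, 67157128149708061016064, 16328532988992653623296, 0, 0, 0, 16328532988992653623296, 67157128149708061016064, 0],
[0, 0, 3877997840140783583232, 0, 0, 0, 0, 3877997840140783583232, 0, 0]],
[[333795592978163564544],
[3467787460400001318912, 3467787460400001318912],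
[1097673576714146414592, 0, 1097673576714146414592],
[0, 0, 0, 0],
[160618608116555493408768, 49356786554473855057920, 137183983528800999702528, 49356786554473855057920, 160618608116555493408768],
[175776948020877909295104, 231320053048821808103424, 901282346317774703296512, 901282346317774703296512, 231320053048821808103424, 175776948020877909295104],
[160618608116555493408768, 231320053048821808103424, 1777551051423930365509632, 3627550910984422463373312, 1777551051423930365509632, 231320053048821808103424, 160618608116555493408768],
[0, 49356786554473855057920, 901282346317774703296512, 3627550910984422463373312, 3627550910984422463373312, 901282346317774703296512, 49356786554473855057920, 0],
[1097673576714146414592, 0, 137183983528800999702528, 901282346317774703296512, 1777551051423930365509632, 901282346317774703296512, 137183983528800999702528, 0, 1097673576714146414592],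
[3467787460400001318912, 0, 0, 49356786554473855057920, 231320053048821808103424, 231320053048821808103424, 49356786554473855057920, 0, 0, 3467787460400001318912],
[333795592978163564544, 3467787460400001318912, 1097673576714146414592, 0, 160618608116555493408768, 175776948020877909295104, 160618608116555493408768, 0, 1097673576714146414592, 3467787460400001318912, 333795592978163564544]],
[[0],
[0, 0],
[0, 5137021320221882843136, 0],
[7641635169242160562176, 5929034176441494798336, 5929034176441494798336, 7641635169242160562176],
[0, 0, 0, 0, 0],
[0, 396122809968957063168, 0, 0, 396122809968957063168, 0],
[0, 0, 0, 0, 0, 0, 0],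
[0, 396122809968957063168, 0, 0, 0, 0, 396122809968957063168, 0],
[7641635169242160562176, 0, 0, 0, 0, 0, 0, 0, 7641635169242160562176],
[0, 5929034176441494798336, 0, 0, 0, 0, 0, 0, 5929034176441494798336, 0],
[0, 5137021320221882843136, 5929034176441494798336, 0, 396122809968957063168, 0, 396122809968957063168, 0, 5929034176441494798336, 5137021320221882843136, 0],
[0, 0, 0, 7641635169242160562176, 0, 0, 0, 0, 7641635169242160562176, 0, 0, 0]]]
def tPn : Tab := [[[0]],
[[5240143411007216904],
[5240143411007216904, 5240143411007216904]],
[[0],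
[0, 0],
[0, 0, 0]],
[[720393040830995233920],
[719160828879432660480, 719160828879432660480],
[719160828879432660480, 686064024641153655936, 719160828879432660480],
[720393040830995233920, 719160828879432660480, 719160828879432660480, 720393040830995233920]],
[[0],
[0, 0],
[0, 0, 0],
[0, 0, 0, 0],
[0, 0, 0, 0, 0]],
[[3783713056035391438848],
[13234701738999180395520, 13234701738999180395520],
[16431519069012915256320, 27066996528249662392320, 16431519069012915256320],
[16431519069012915256320, 55596175387107555280896, 55596175387107555280896, 16431519069012915256320],
[13234701738999180395520, 27066996528249662392320, 55596175387107555280896, 27066996528249662392320, 13234701738999180395520],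
[3783713056035391438848, 13234701738999180395520, 16431519069012915256320, 16431519069012915256320, 13234701738999180395520, 3783713056035391438848]],
[[0],
[0, 0],
[0, 0, 0],
[0, 0, 0, 0],
[0, 0, 0, 0, 0],
[0, 0, 0, 0, 0, 0],
[0, 0, 0, 0, 0, 0, 0]],
[[5070532792340130988032],
[32104058379621886771200, 32104058379621886771200],
[21029924290371865804800, 11028675952290056159232, 21029924290371865804800],
[171149904973587323289600, 176146456487881986736128, 176146456487881986736128, 171149904973587323289600],
[171149904973587323289600, 452561378430327244996608, 1386055251804637045260288, 452561378430327244996608, 171149904973587323289600],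
[21029924290371865804800, 176146456487881986736128, 1386055251804637045260288, 1386055251804637045260288, 176146456487881986736128, 21029924290371865804800],
[32104058379621886771200, 11028675952290056159232, 176146456487881986736128, 452561378430327244996608, 176146456487881986736128, 11028675952290056159232, 32104058379621886771200],
[5070532792340130988032, 32104058379621886771200, 21029924290371865804800, 171149904973587323289600, 171149904973587323289600, 21029924290371865804800, 32104058379621886771200, 5070532792340130988032]],
[[0],
[0, 0],
[0, 49668738924581629526016, 0],
[0, 0, 0, 0],
[0, 0, 0, 0, 0],
[0, 0, 0, 0, 0, 0],
[0, 0, 0, 0, 0, 0, 0],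
[0, 49668738924581629526016, 0, 0, 0, 0, 49668738924581629526016, 0],
[0, 0, 0, 0, 0, 0, 0, 0, 0]],
[[1294871882866338299904],
[11796380599994006372352, 11796380599994006372352],
[0, 0, 0],
[58338833538732458508288, 0, 0, 58338833538732458508288],
[383087065171917386022912, 203817895995787835867136, 704210627580694720413696, 203817895995787835867136, 383087065171917386022912],
[383087065171917386022912, 647262703418517465071616, 3001426170357321959473152, 3001426170357321959473152, 647262703418517465071616, 383087065171917386022912],
[58338833538732458508288, 203817895995787835867136, 3001426170357321959473152, 6184401570595818312302592, 3001426170357321959473152, 203817895995787835867136, 58338833538732458508288],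
[0, 0, 704210627580694720413696, 3001426170357321959473152, 3001426170357321959473152, 704210627580694720413696, 0, 0],
[11796380599994006372352, 0, 0, 203817895995787835867136, 647262703418517465071616, 203817895995787835867136, 0, 0, 11796380599994006372352],
[1294871882866338299904, 11796380599994006372352, 0, 58338833538732458508288, 383087065171917386022912, 383087065171917386022912, 58338833538732458508288, 0, 11796380599994006372352, 1294871882866338299904]],
[[0],
[0, 0],
[0, 32133006791595484250112, 0],
[11142048945498957545472, 18135172437460981383168, 18135172437460981383168, 11142048945498957545472],
[0, 0, 0, 0, 0],
[0, 0, 0, 0, 0, 0],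
[0, 0, 0, 0, 0, 0, 0],
[11142048945498957545472, 0, 0, 0, 0, 0, 0, 11142048945498957545472],
[0, 18135172437460981383168, 0, 0, 0, 0, 0, 18135172437460981383168, 0],
[0, 32133006791595484250112, 18135172437460981383168, 0, 0, 0, 0, 18135172437460981383168, 32133006791595484250112, 0],
[0, 0, 0, 11142048945498957545472, 0, 0, 0, 11142048945498957545472, 0, 0, 0]],
[[36050546215304036352],
[438128555644183117824, 438128555644183117824],
[1062228465730556264448, 0, 1062228465730556264448],
[0, 0, 0, 0],
[26368042059230563270656, 17673747673644439437312, 13781785842029514719232, 17673747673644439437312, 26368042059230563270656],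
[29233664772692181516288, 0, 82507047079409658888192, 82507047079409658888192, 0, 29233664772692181516288],
[29233664772692181516288, 93050699046422021406720, 276404930215243306500096, 575043082506834800541696, 276404930215243306500096, 93050699046422021406720, 29233664772692181516288],
[26368042059230563270656, 0, 276404930215243306500096, 1037426261649647997026304, 1037426261649647997026304, 276404930215243306500096, 0, 26368042059230563270656],
[0, 17673747673644439437312, 82507047079409658888192, 575043082506834800541696, 1037426261649647997026304, 575043082506834800541696, 82507047079409658888192, 17673747673644439437312, 0],
[1062228465730556264448, 0, 13781785842029514719232, 82507047079409658888192, 276404930215243306500096, 276404930215243306500096, 82507047079409658888192, 13781785842029514719232, 0, 1062228465730556264448],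
[438128555644183117824, 0, 0, 17673747673644439437312, 0, 93050699046422021406720, 0, 17673747673644439437312, 0, 0, 438128555644183117824],
[36050546215304036352, 438128555644183117824, 1062228465730556264448, 0, 26368042059230563270656, 29233664772692181516288, 29233664772692181516288, 26368042059230563270656, 0, 1062228465730556264448, 438128555644183117824, 36050546215304036352]]]
def sP : ℕ := 97566047550591117363050542
def tHp : Tab := [[[0]],
[[0],
[0, 0]],
[[232368676751733118848],
[144001829793271106592, 144001829793271106592],
[232368676751733118848, 144001829793271106592, 232368676751733118848]],
[[0],
[0, 0],
[0, 0, 0],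
[0, 0, 0, 0]],
[[1120743292115863710720],
[2754930326389081422336, 2754930326389081422336],
[4206356439692989070592, 4734567723624953485824, 4206356439692989070592],
[2754930326389081422336, 4734567723624953485824, 4734567723624953485824, 2754930326389081422336],
[1120743292115863710720, 2754930326389081422336, 4206356439692989070592, 2754930326389081422336, 1120743292115863710720]],
[[0],
[0, 0],
[0, 0, 0],
[0, 0, 0, 0],
[0, 0, 0, 0, 0],
[0, 0, 0, 0, 0, 0]],
[[6999691276096611692544],
[18621978436040527724544, 18621978436040527724544],
[27817383658901977939968, 9104304648052092100608, 27817383658901977939968],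
[60283596838945631477760, 161272260846977525231616, 161272260846977525231616, 60283596838945631477760],
[27817383658901977939968, 161272260846977525231616, 388493310117975435546624, 161272260846977525231616, 27817383658901977939968],
[18621978436040527724544, 9104304648052092100608, 161272260846977525231616, 161272260846977525231616, 9104304648052092100608, 18621978436040527724544],
[6999691276096611692544, 18621978436040527724544, 27817383658901977939968, 60283596838945631477760, 27817383658901977939968, 18621978436040527724544, 6999691276096611692544]],
[[0],
[0, 0],
[0, 35325779864527821127680, 0],
[0, 0, 0, 0],
[0, 0, 0, 0, 0],
[0, 0, 0, 0, 0, 0],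
[0, 35325779864527821127680, 0, 0, 0, 35325779864527821127680, 0],
[0, 0, 0, 0, 0, 0, 0, 0]],
[[5255531897506635644928],
[24722378964903600193536, 24722378964903600193536],
[28636698654898714312704, 0, 28636698654898714312704],
[159302495203802739965952, 223413731885551257649152, 223413731885551257649152, 159302495203802739965952],
[321754889524396400050176, 702464871710299207827456, 1493568400520735694913536, 702464871710299207827456, 321754889524396400050176],
[159302495203802739965952, 702464871710299207827456, 2757563158130029576912896, 2757563158130029576912896, 702464871710299207827456, 159302495203802739965952],
[28636698654898714312704, 223413731885551257649152, 1493568400520735694913536, 2757563158130029576912896, 1493568400520735694913536, 223413731885551257649152, 28636698654898714312704],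
[24722378964903600193536, 0, 223413731885551257649152, 702464871710299207827456, 702464871710299207827456, 223413731885551257649152, 0, 24722378964903600193536],
[5255531897506635644928, 24722378964903600193536, 28636698654898714312704, 159302495203802739965952, 321754889524396400050176, 159302495203802739965952, 28636698654898714312704, 24722378964903600193536, 5255531897506635644928]],
[[0],
[0, 0],
[0, 99975799968317063036928, 0],
[0, 0, 0, 0],
[0, 0, 0, 0, 0],
[0, 0, 0, 0, 0, 0],
[0, 0, 0, 0, 0, 0, 0],
[0, 0, 0, 0, 0, 0, 0, 0],
[0, 99975799968317063036928, 0, 0, 0, 0, 0, 99975799968317063036928, 0],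
[0, 0, 0, 0, 0, 0, 0, 0, 0, 0]],
[[433198847607136321536],
[3572277126813019275264, 3572277126813019275264],
[2399609218427620687872, 0, 2399609218427620687872],
[0, 0, 0, 0],
[148932276829374545657856, 124998370287107073638400, 173595510138446967472128, 124998370287107073638400, 148932276829374545657856],
[153547589399271255834624, 253643858028053161574400, 916255102921422969765888, 916255102921422969765888, 253643858028053161574400, 153547589399271255834624],
[148932276829374545657856, 253643858028053161574400, 1592268752252454429523968, 3370183202781232024780800, 1592268752252454429523968, 253643858028053161574400, 148932276829374545657856],
[0, 124998370287107073638400, 916255102921422969765888, 3370183202781232024780800, 3370183202781232024780800, 916255102921422969765888, 124998370287107073638400, 0],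
[2399609218427620687872, 0, 173595510138446967472128, 916255102921422969765888, 1592268752252454429523968, 916255102921422969765888, 173595510138446967472128, 0, 2399609218427620687872],
[3572277126813019275264, 0, 0, 124998370287107073638400, 253643858028053161574400, 253643858028053161574400, 124998370287107073638400, 0, 0, 3572277126813019275264],
[433198847607136321536, 3572277126813019275264, 2399609218427620687872, 0, 148932276829374545657856, 153547589399271255834624, 148932276829374545657856, 0, 2399609218427620687872, 3572277126813019275264, 433198847607136321536]],
[[0],
[0, 0],
[0, 5137021320221882843136, 0],
[7641635169242160562176, 5929034176441494798336, 5929034176441494798336, 7641635169242160562176],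
[0, 0, 0, 0, 0],
[0, 396122809968957063168, 0, 0, 396122809968957063168, 0],
[0, 0, 0, 0, 0, 0, 0],
[0, 396122809968957063168, 0, 0, 0, 0, 396122809968957063168, 0],
[7641635169242160562176, 0, 0, 0, 0, 0, 0, 0, 7641635169242160562176],
[0, 5929034176441494798336, 0, 0, 0, 0, 0, 0, 5929034176441494798336, 0],
[0, 5137021320221882843136, 5929034176441494798336, 0, 396122809968957063168, 0, 396122809968957063168, 0, 5929034176441494798336, 5137021320221882843136, 0],
[0, 0, 0, 7641635169242160562176, 0, 0, 0, 0, 7641635169242160562176, 0, 0, 0]]]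
def tHn : Tab := [[[18446744073709551613]],
[[39223886684364649464],
[39223886684364649464, 39223886684364649464]],
[[0],
[0, 0],
[0, 0, 0]],
[[228891426237543494016],
[554438186967791879424, 554438186967791879424],
[554438186967791879424, 149353769319416593344, 554438186967791879424],
[228891426237543494016, 554438186967791879424, 554438186967791879424, 228891426237543494016]],
[[0],
[0, 0],
[0, 0, 0],
[0, 0, 0, 0],
[0, 0, 0, 0, 0]],
[[4123542818083523088384],
[8371328031184331086848, 8371328031184331086848],
[16267596514994278490112, 13766357943628680241152, 16267596514994278490112],
[16267596514994278490112, 50624609397383784572928, 50624609397383784572928, 16267596514994278490112],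
[8371328031184331086848, 13766357943628680241152, 50624609397383784572928, 13766357943628680241152, 8371328031184331086848],
[4123542818083523088384, 8371328031184331086848, 16267596514994278490112, 16267596514994278490112, 8371328031184331086848, 4123542818083523088384]],
[[0],
[0, 0],
[0, 0, 0],
[0, 0, 0, 0],
[0, 0, 0, 0, 0],
[0, 0, 0, 0, 0, 0],
[0, 0, 0, 0, 0, 0, 0]],
[[7645658145051315142656],
[28494467544372814282752, 28494467544372814282752],
[35866026976392434073600, 0, 35866026976392434073600],
[133149170905600441171968, 269553941696797687627776, 269553941696797687627776, 133149170905600441171968],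
[133149170905600441171968, 506049698482421003108352, 1124889537932723922665472, 506049698482421003108352, 133149170905600441171968],
[35866026976392434073600, 269553941696797687627776, 1124889537932723922665472, 1124889537932723922665472, 269553941696797687627776, 35866026976392434073600],
[28494467544372814282752, 0, 269553941696797687627776, 506049698482421003108352, 269553941696797687627776, 0, 28494467544372814282752],
[7645658145051315142656, 28494467544372814282752, 35866026976392434073600, 133149170905600441171968, 133149170905600441171968, 35866026976392434073600, 28494467544372814282752, 7645658145051315142656]],
[[0],
[0, 0],
[0, 102310837451281217028096, 0],
[0, 0, 0, 0],
[0, 0, 0, 0, 0],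
[0, 0, 0, 0, 0, 0],
[0, 0, 0, 0, 0, 0, 0],
[0, 102310837451281217028096, 0, 0, 0, 0, 102310837451281217028096, 0],
[0, 0, 0, 0, 0, 0, 0, 0, 0]],
[[2090521787546790789120],
[12489651032718717222912, 12489651032718717222912],
[8421385796232722251776, 0, 8421385796232722251776],
[81473391685834018652160, 62660352527378610388992, 62660352527378610388992, 81473391685834018652160],
[310199765257458610864128, 441619879553877832630272, 823058271511781464866816, 441619879553877832630272, 310199765257458610864128],
[310199765257458610864128, 684656397297766056591360, 2652482588995446509666304, 2652482588995446509666304, 684656397297766056591360, 310199765257458610864128],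
[81473391685834018652160, 441619879553877832630272, 2652482588995446509666304, 5283614591884651777228800, 2652482588995446509666304, 441619879553877832630272, 81473391685834018652160],
[8421385796232722251776, 62660352527378610388992, 823058271511781464866816, 2652482588995446509666304, 2652482588995446509666304, 823058271511781464866816, 62660352527378610388992, 8421385796232722251776],
[12489651032718717222912, 0, 62660352527378610388992, 441619879553877832630272, 684656397297766056591360, 441619879553877832630272, 62660352527378610388992, 0, 12489651032718717222912],
[2090521787546790789120, 12489651032718717222912, 8421385796232722251776, 81473391685834018652160, 310199765257458610864128, 310199765257458610864128, 81473391685834018652160, 8421385796232722251776, 12489651032718717222912, 2090521787546790789120]],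
[[0],
[0, 0],
[0, 39293049217675016798208, 0],
[2276058969247630491648, 12172091813883659943936, 12172091813883659943936, 2276058969247630491648],
[0, 0, 0, 0, 0],
[0, 0, 0, 0, 0, 0],
[0, 0, 0, 0, 0, 0, 0],
[2276058969247630491648, 0, 0, 0, 0, 0, 0, 2276058969247630491648],
[0, 12172091813883659943936, 0, 0, 0, 0, 0, 12172091813883659943936, 0],
[0, 39293049217675016798208, 12172091813883659943936, 0, 0, 0, 0, 12172091813883659943936, 39293049217675016798208, 0],
[0, 0, 0, 2276058969247630491648, 0, 0, 0, 2276058969247630491648, 0, 0, 0]],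
[[36050546215304036352],
[438128555644183117824, 438128555644183117824],
[1062228465730556264448, 0, 1062228465730556264448],
[0, 0, 0, 0],
[26368042059230563270656, 17673747673644439437312, 13781785842029514719232, 17673747673644439437312, 26368042059230563270656],
[29233664772692181516288, 0, 82507047079409658888192, 82507047079409658888192, 0, 29233664772692181516288],
[29233664772692181516288, 93050699046422021406720, 276404930215243306500096, 575043082506834800541696, 276404930215243306500096, 93050699046422021406720, 29233664772692181516288],
[26368042059230563270656, 0, 276404930215243306500096, 1037426261649647997026304, 1037426261649647997026304, 276404930215243306500096, 0, 26368042059230563270656],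
[0, 17673747673644439437312, 82507047079409658888192, 575043082506834800541696, 1037426261649647997026304, 575043082506834800541696, 82507047079409658888192, 17673747673644439437312, 0],
[1062228465730556264448, 0, 13781785842029514719232, 82507047079409658888192, 276404930215243306500096, 276404930215243306500096, 82507047079409658888192, 13781785842029514719232, 0, 1062228465730556264448],
[438128555644183117824, 0, 0, 17673747673644439437312, 0, 93050699046422021406720, 0, 17673747673644439437312, 0, 0, 438128555644183117824],
[36050546215304036352, 438128555644183117824, 1062228465730556264448, 0, 26368042059230563270656, 29233664772692181516288, 29233664772692181516288, 26368042059230563270656, 0, 1062228465730556264448, 438128555644183117824, 36050546215304036352]]]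
def sH : ℕ := 95128012172681315093957125
def trP : Tr := (.n0 (.n0 (.n0 (.lf 4) (.n1 (.lf 4) (.n0 (.lf 4) (.n1 (.lf 4) (.n2 (.lf 4) (.n0 (.lf 4) (.n0 (.lf 4) (.n1 (.lf 4) (.n2 (.lf 4) (.n0 (.lf 4) (.n1 (.lf 4) (.n2 (.lf 4) (.n0 (.n1 (.lf 4) (.n2 (.lf 4) (.n0 (.lf 2144) (.lf 2116)))) (.n1 (.n2 (.lf 4) (.n1 (.lf 2176) (.lf 2116))) (.n2 (.n0 (.lf 2144) (.lf 2120)) (.n0 (.n1 (.lf 2112) (.lf 2080)) (.n1 (.lf 2080) (.lf 2048)))))))))))))))))) (.n0 (.n0 (.n1 (.lf 4096) (.n0 (.n1 (.n2 (.lf 4) (.lf 2172)) (.n2 (.n0 (.lf 4) (.n1 (.lf 4) (.n2 (.lf 2272) (.n0 (.n1 (.lf 4) (.n2 (.lf 4) (.n0 (.lf 4) (.n1 (.lf 4) (.n2 (.lf 2304) (.lf 2208)))))) (.n1 (.n2 (.lf 4) (.lf 2224)) (.n2 (.lf 2248) (.n0 (.n1 (.lf 2222) (.n2 (.lf 2224)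 (.n0 (.lf 2208) (.lf 2176)))) (.n1 (.n2 (.lf 2224) (.lf 2192)) (.n2 (.lf 2208) (.lf 3)))))))))) (.n1 (.n0 (.n2 (.lf 4) (.n1 (.lf 4) (.n0 (.lf 4) (.n2 (.lf 4) (.n1 (.lf 2144) (.n0 (.lf 2136) (.n2 (.lf 2144) (.n1 (.lf 2112) (.lf 2080))))))))) (.n2 (.n0 (.lf 2304) (.n1 (.lf 2304) (.n2 (.lf 2240) (.n0 (.lf 2168) (.n1 (.lf 2176) (.n2 (.lf 2176) (.lf 2112))))))) (.n1 (.n0 (.n2 (.lf 4) (.n1 (.lf 2176) (.n0 (.lf 2176) (.n2 (.lf 2176) (.lf 2112))))) (.n2 (.n0 (.lf 2176) (.n1 (.lf 2176) (.lf 2144))) (.n1 (.n0 (.lf 2144) (.lf 2104)) (.n0 (.n2 (.lf 2112) (.lf 2048)) (.lf 1920))))) (.n0 (.n2 (.n0 (.lf 2152) (.n1 (.lf 2160) (.n2 (.lf 2144) (.lf 2104)))) (.n1 (.n0 (.n2 (.lf 2144) (.n1 (.lf 2112) (.lf 2080))) (.n2 (.lf 2112) (.lf 2048))) (.n0 (.n2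 (.n1 (.lf 2112) (.lf 2080)) (.lf 2048)) (.lf 1792)))) (.n2 (.n0 (.n1 (.n2 (.lf 2176) (.lf 2112)) (.n2 (.lf 2112) (.lf 3))) (.n1 (.n2 (.lf 2112) (.lf 3)) (.lf 3))) (.lf 1792)))))) (.n0 (.n2 (.n0 (.lf 2560) (.n1 (.lf 2304) (.n2 (.lf 2208) (.n0 (.n1 (.lf 2304) (.n2 (.lf 2304) (.n0 (.lf 2176) (.lf 2140)))) (.n1 (.n2 (.lf 2176) (.n0 (.lf 2160) (.lf 2144))) (.n2 (.n0 (.lf 2176) (.lf 2152)) (.n0 (.n1 (.lf 2128) (.lf 2112)) (.lf 2080)))))))) (.n0 (.n1 (.n2 (.lf 4) (.n0 (.n1 (.lf 4) (.n2 (.lf 4) (.n1 (.lf 2176) (.lf 2120)))) (.n1 (.n2 (.lf 4) (.lf 2128)) (.n2 (.n1 (.lf 2176) (.lf 2120)) (.n1 (.n0 (.lf 2112) (.lf 2080)) (.n0 (.lf 2080) (.lf 2048))))))) (.n2 (.n0 (.n1 (.lf 4) (.n2 (.lf 4) (.n0 (.lf 2144) (.lf 2124)))) (.n1 (.n2 (.lf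 8192) (.n0 (.lf 2144) (.lf 2124))) (.n2 (.n0 (.lf 2144) (.lf 2132)) (.n0 (.n1 (.lf 2112) (.lf 2080)) (.lf 2080))))) (.n0 (.n1 (.n2 (.n0 (.lf 2144) (.lf 2120)) (.n1 (.n0 (.lf 2112) (.lf 2080)) (.n0 (.lf 2080) (.lf 2048)))) (.n2 (.n0 (.n1 (.lf 2112) (.lf 2080)) (.n1 (.lf 2080) (.lf 2048))) (.lf 1920))) (.n1 (.n2 (.n0 (.n1 (.lf 2112) (.lf 2080)) (.lf 2076)) (.lf 1920)) (.lf 1792))))) (.n1 (.n2 (.n0 (.n1 (.lf 4) (.n2 (.lf 3072) (.n0 (.lf 2176) (.lf 2128)))) (.n1 (.n2 (.lf 2560) (.lf 2136)) (.n2 (.n0 (.lf 2176) (.lf 2136)) (.n0 (.lf 2108) (.lf 2080))))) (.n1 (.n0 (.n2 (.lf 2128) (.n1 (.lf 2108) (.lf 2080))) (.n2 (.n1 (.lf 2112) (.lf 2080)) (.lf 1984))) (.n0 (.n2 (.n0 (.n1 (.lf 2112) (.lf 2080)) (.lf 2080)) (.lf 1920)) (.lf 1792)))) (.n2 (.n0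 (.n1 (.n2 (.n0 (.lf 2144) (.lf 2132)) (.n0 (.n1 (.lf 2112) (.lf 2080)) (.lf 2080))) (.n2 (.n0 (.n1 (.lf 2128) (.lf 2080)) (.lf 2080)) (.lf 3))) (.n1 (.n2 (.n0 (.n1 (.lf 2128) (.lf 2112)) (.lf 2080)) (.lf 3)) (.lf 3))) (.lf 1792))))) (.n2 (.n0 (.n1 (.n2 (.lf 2208) (.n0 (.n1 (.lf 2304) (.n2 (.lf 2176) (.lf 2148))) (.n1 (.n2 (.lf 2176) (.lf 2152)) (.n2 (.lf 2160) (.lf 2112))))) (.n2 (.n0 (.n1 (.lf 2208) (.n2 (.lf 2208) (.n0 (.lf 2176) (.lf 2166)))) (.n1 (.n2 (.lf 2208) (.n0 (.lf 2176) (.lf 2160))) (.n2 (.n0 (.lf 2192) (.lf 2176)) (.lf 2136)))) (.n0 (.n1 (.n2 (.n0 (.lf 2176) (.lf 2152)) (.n0 (.lf 2120) (.lf 2048))) (.n2 (.n0 (.lf 2136) (.lf 2048)) (.lf 3))) (.n1 (.n2 (.lf 2120) (.lf 3)) (.lf 3))))) (.n1 (.n2 (.n0 (.n1 (.lf 2208)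 (.n2 (.lf 2208) (.lf 2172))) (.n1 (.n2 (.lf 2208) (.lf 2176)) (.n2 (.lf 2192) (.lf 2048)))) (.n0 (.n1 (.n2 (.lf 2160) (.lf 2112)) (.n2 (.lf 2112) (.lf 3))) (.n1 (.lf 2080) (.lf 3)))) (.n2 (.n0 (.n1 (.n2 (.n0 (.lf 2192) (.lf 2176)) (.lf 2112)) (.lf 2048)) (.lf 3)) (.lf 3)))) (.n2 (.n0 (.n1 (.n0 (.n1 (.n2 (.lf 2144) (.n0 (.lf 2112) (.lf 2080))) (.n2 (.n0 (.lf 2112) (.lf 2048)) (.lf 3))) (.n1 (.n2 (.lf 2108) (.lf 3)) (.lf 3))) (.lf 3)) (.lf 3)) (.n0 (.lf 1664) (.lf 3)))))))) (.n1 (.n0 (.n2 (.lf 4) (.n1 (.lf 2304) (.n2 (.lf 2208) (.n1 (.lf 2160) (.n0 (.n2 (.lf 2176) (.n1 (.lf 2144) (.n0 (.lf 2112) (.lf 2048)))) (.n2 (.n0 (.lf 2144) (.lf 2048)) (.lf 1920))))))) (.n2 (.lf 2304) (.n1 (.lf 2176) (.n2 (.n0 (.lf 2160) (.n1 (.lf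 2176) (.lf 2048))) (.n0 (.n1 (.n2 (.lf 2176) (.lf 2048)) (.lf 3)) (.lf 3)))))) (.n2 (.n0 (.n1 (.n0 (.lf 2240) (.n1 (.lf 2304) (.n2 (.lf 2304) (.lf 2216)))) (.n0 (.n1 (.n2 (.lf 2240) (.n2 (.lf 2240) (.n0 (.n1 (.lf 2240) (.n2 (.lf 2240) (.lf 2176))) (.n1 (.lf 2208) (.lf 2048))))) (.n2 (.lf 2272) (.n0 (.n2 (.lf 2240) (.lf 2144)) (.lf 2048)))) (.n1 (.n2 (.lf 2240) (.n0 (.n2 (.lf 2240) (.lf 3)) (.lf 3))) (.lf 3)))) (.n1 (.n0 (.n1 (.lf 2240) (.n2 (.lf 2304) (.lf 2112))) (.lf 2080)) (.lf 3))) (.n0 (.n1 (.n2 (.n0 (.n1 (.n2 (.lf 2304) (.lf 2168)) (.n2 (.n0 (.lf 2192) (.n1 (.lf 2176) (.lf 2144))) (.n0 (.n1 (.lf 2144) (.lf 2048)) (.lf 2048)))) (.n1 (.n2 (.lf 2176) (.n0 (.lf 2128) (.lf 2048))) (.n2 (.lf 2112) (.lf 3)))) (.n1 (.n0 (.n2 (.n0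 (.n1 (.lf 2144) (.lf 2080)) (.lf 2064)) (.lf 1920)) (.lf 3)) (.lf 3))) (.n2 (.n2 (.n0 (.n1 (.n0 (.n1 (.n2 (.lf 2176) (.lf 2048)) (.lf 3)) (.lf 3)) (.lf 3)) (.lf 3)) (.lf 3)) (.lf 3))) (.n1 (.n2 (.n0 (.n0 (.lf 1912) (.lf 3)) (.lf 3)) (.lf 3)) (.lf 3))))))) (.n1 (.n0 (.lf 2304) (.n1 (.n0 (.n0 (.lf 2048) (.n1 (.n0 (.lf 2048) (.n0 (.n1 (.lf 2000) (.lf 2048)) (.lf 3))) (.lf 2048))) (.lf 3)) (.n0 (.lf 2048) (.lf 3)))) (.n1 (.n2 (.n0 (.n0 (.lf 2176) (.lf 1792)) (.lf 3)) (.n0 (.n1 (.n0 (.n0 (.n2 (.lf 2304) (.lf 2080)) (.lf 1984)) (.lf 3)) (.lf 3)) (.lf 3))) (.n2 (.lf 3) (.n0 (.lf 3) (.n2 (.n1 (.lf 3) (.n2 (.lf 3) (.n0 (.lf 3) (.lf 3)))) (.n1 (.lf 3) (.n0 (.lf 3) (.lf 3))))))))) (.n1 (.n1 (.lf 3) (.n0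 (.lf 3) (.n1 (.lf 3) (.n2 (.lf 3) (.n0 (.lf 3) (.n0 (.lf 3) (.lf 3))))))) (.n0 (.n1 (.n2 (.lf 3) (.n1 (.n0 (.lf 3) (.n2 (.lf 3) (.n1 (.lf 3) (.n0 (.lf 3) (.n0 (.lf 3) (.lf 3)))))) (.n0 (.n2 (.lf 3) (.n1 (.lf 3) (.n0 (.lf 3) (.n1 (.lf 3) (.lf 3))))) (.n2 (.n0 (.n1 (.lf 3) (.lf 3)) (.n1 (.lf 3) (.lf 3))) (.n1 (.n0 (.n2 (.lf 3) (.lf 3)) (.n1 (.lf 3) (.lf 3))) (.n0 (.n2 (.lf 3) (.lf 3)) (.lf 3))))))) (.n2 (.n0 (.n2 (.lf 3) (.n1 (.lf 3) (.n0 (.lf 3) (.n2 (.lf 3) (.n0 (.lf 3) (.lf 3)))))) (.n2 (.n0 (.lf 3) (.n1 (.lf 3) (.n0 (.n1 (.lf 3) (.lf 3)) (.n1 (.lf 3) (.lf 3))))) (.n1 (.n0 (.lf 3) (.lf 3)) (.n2 (.n0 (.lf 3) (.lf 3)) (.lf 3))))) (.n0 (.n2 (.n1 (.n0 (.n1 (.lf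 3) (.lf 3)) (.n2 (.n1 (.lf 3) (.lf 3)) (.n1 (.lf 3) (.lf 3)))) (.n0 (.n2 (.n1 (.lf 3) (.n0 (.lf 3) (.lf 3))) (.n0 (.lf 3) (.lf 3))) (.n2 (.n1 (.lf 3) (.lf 3)) (.lf 3)))) (.n1 (.n0 (.n1 (.lf 3) (.lf 3)) (.n1 (.lf 3) (.lf 3))) (.lf 3))) (.n2 (.n1 (.n2 (.n0 (.n1 (.lf 3) (.lf 3)) (.lf 3)) (.n0 (.n1 (.lf 3) (.lf 3)) (.lf 3))) (.lf 3)) (.lf 3))))) (.n1 (.n2 (.n0 (.n0 (.lf 3) (.lf 3)) (.lf 3)) (.n1 (.n0 (.n2 (.lf 3) (.n1 (.lf 3) (.lf 3))) (.n1 (.lf 3) (.lf 3))) (.n2 (.n0 (.lf 3) (.lf 3)) (.lf 3)))) (.n2 (.n1 (.n0 (.n0 (.lf 3) (.lf 3)) (.lf 3)) (.n0 (.n1 (.lf 3) (.lf 3)) (.lf 3))) (.lf 3))))))) (.n1 (.n0 (.n0 (.n1 (.n0 (.lf 3) (.n1 (.n0 (.lf 3) (.n0 (.lf 3) (.lf 3)))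 (.n0 (.lf 3) (.n1 (.lf 3) (.n0 (.lf 3) (.lf 3)))))) (.n0 (.n1 (.n2 (.lf 3) (.n1 (.lf 3) (.lf 3))) (.n2 (.lf 3) (.lf 3))) (.n1 (.n2 (.lf 3) (.n0 (.n1 (.lf 3) (.lf 3)) (.lf 3))) (.n0 (.lf 3) (.n0 (.lf 3) (.lf 3)))))) (.n1 (.n1 (.n0 (.n1 (.n1 (.lf 3) (.n0 (.lf 3) (.lf 3))) (.n0 (.lf 3) (.lf 3))) (.n1 (.n1 (.n0 (.n1 (.lf 3) (.lf 3)) (.lf 3)) (.lf 3)) (.lf 3))) (.n0 (.n0 (.n2 (.n1 (.lf 3) (.lf 3)) (.n0 (.lf 3) (.lf 3))) (.lf 3)) (.lf 3))) (.n0 (.lf 3) (.n1 (.n0 (.lf 3) (.lf 3)) (.lf 3))))) (.n1 (.n1 (.lf 3) (.lf 3)) (.lf 3))) (.n0 (.n0 (.n0 (.n2 (.lf 3) (.n1 (.lf 3) (.n0 (.lf 3) (.lf 3)))) (.n2 (.n1 (.lf 3) (.n0 (.n2 (.lf 3) (.lf 3)) (.n2 (.lf 3) (.lf 3)))) (.n1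 (.n0 (.n1 (.lf 3) (.lf 3)) (.lf 3)) (.lf 3)))) (.n1 (.n2 (.n0 (.lf 3) (.lf 3)) (.lf 3)) (.n2 (.lf 3) (.lf 3)))) (.lf 3))))
def trH : Tr := (.n0 (.n0 (.n0 (.lf 3) (.n0 (.lf 3) (.n1 (.lf 3) (.n0 (.lf 3) (.n1 (.lf 3) (.n2 (.lf 3) (.n0 (.n1 (.lf 3) (.n2 (.lf 3) (.n0 (.lf 3) (.lf 3)))) (.n1 (.n2 (.lf 3) (.lf 3)) (.n2 (.n2 (.lf 3) (.n0 (.lf 3) (.lf 3))) (.n1 (.n0 (.lf 3) (.lf 3)) (.n0 (.lf 3) (.lf 3)))))))))))) (.n0 (.n0 (.n1 (.lf 3) (.n0 (.n1 (.n2 (.lf 3) (.n0 (.lf 3) (.lf 3))) (.n2 (.n0 (.n1 (.lf 3) (.n2 (.lf 3) (.n0 (.n2 (.lf 3) (.lf 3)) (.n2 (.lf 3) (.n1 (.lf 3) (.lf 3)))))) (.n1 (.lf 3) (.n2 (.n0 (.lf 3) (.n2 (.n2 (.n0 (.lf 3) (.lf 3)) (.n0 (.lf 3) (.lf 3))) (.lf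 3))) (.n1 (.lf 3) (.n0 (.lf 3) (.lf 3)))))) (.n1 (.n0 (.n2 (.lf 3) (.lf 3)) (.lf 3)) (.n0 (.n2 (.n0 (.n1 (.lf 3) (.n2 (.lf 3) (.lf 3))) (.n1 (.lf 3) (.lf 3))) (.lf 3)) (.lf 3))))) (.n1 (.n2 (.lf 3) (.lf 3)) (.n2 (.n1 (.lf 3) (.n2 (.n0 (.n1 (.lf 3) (.n2 (.lf 3) (.lf 3))) (.lf 3)) (.lf 3))) (.lf 3))))) (.n1 (.n0 (.n1 (.lf 3) (.lf 3)) (.n1 (.n0 (.n1 (.n0 (.n1 (.lf 3) (.lf 3)) (.n1 (.n0 (.n1 (.n0 (.lf 3) (.n1 (.lf 3) (.lf 3))) (.n0 (.lf 3) (.lf 3))) (.lf 3)) (.lf 3))) (.lf 3)) (.lf 3)) (.lf 3))) (.n2 (.lf 3) (.n1 (.lf 3) (.lf 3))))) (.n1 (.n1 (.lf 3) (.n0 (.lf 3) (.n1 (.lf 3) (.n2 (.lf 3) (.n0 (.lf 3) (.n1 (.lf 3) (.lf 3))))))) (.n0 (.n1 (.n2 (.lf 3) (.n1 (.n0 (.lf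 3) (.n1 (.lf 3) (.lf 3))) (.n0 (.lf 3) (.n2 (.lf 3) (.n0 (.lf 3) (.lf 3)))))) (.n2 (.n0 (.n0 (.lf 3) (.n1 (.lf 3) (.n2 (.lf 3) (.lf 3)))) (.n2 (.n0 (.n2 (.lf 3) (.lf 3)) (.n1 (.lf 3) (.lf 3))) (.lf 3))) (.n0 (.n1 (.n2 (.lf 3) (.lf 3)) (.n0 (.n1 (.lf 3) (.lf 3)) (.lf 3))) (.n1 (.lf 3) (.lf 3))))) (.n2 (.n1 (.lf 3) (.lf 3)) (.n1 (.n1 (.n0 (.n1 (.lf 3) (.n0 (.lf 3) (.lf 3))) (.lf 3)) (.lf 3)) (.n0 (.lf 3) (.lf 3)))))))) (.n1 (.n0 (.n1 (.n0 (.n0 (.lf 3) (.n1 (.lf 3) (.n0 (.n1 (.lf 3) (.lf 3)) (.n1 (.n2 (.lf 3) (.n0 (.lf 3) (.n1 (.n0 (.lf 3) (.lf 3)) (.lf 3)))) (.n2 (.lf 3) (.n0 (.lf 3) (.lf 3))))))) (.n1 (.n0 (.n0 (.n1 (.lf 3) (.n0 (.n2 (.lf 3) (.n1 (.lf 3) (.n0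 (.lf 3) (.lf 3)))) (.n2 (.lf 3) (.n1 (.lf 3) (.lf 3))))) (.n1 (.n1 (.n1 (.lf 3) (.n0 (.lf 3) (.lf 3))) (.n0 (.lf 3) (.lf 3))) (.lf 3))) (.n1 (.n1 (.n1 (.lf 3) (.lf 3)) (.lf 3)) (.lf 3))) (.n0 (.n0 (.n2 (.n1 (.n0 (.n1 (.n2 (.lf 3) (.lf 3)) (.n2 (.lf 3) (.lf 3))) (.n1 (.n2 (.n0 (.lf 3) (.lf 3)) (.n0 (.lf 3) (.lf 3))) (.n2 (.lf 3) (.lf 3)))) (.lf 3)) (.n1 (.n0 (.n1 (.n2 (.n0 (.lf 3) (.lf 3)) (.lf 3)) (.lf 3)) (.lf 3)) (.lf 3))) (.lf 3)) (.lf 3)))) (.n0 (.n0 (.n1 (.n0 (.lf 3) (.n1 (.lf 3) (.n2 (.lf 3) (.n0 (.lf 3) (.lf 3))))) (.n2 (.lf 3) (.n0 (.n1 (.lf 3) (.lf 3)) (.lf 3)))) (.n1 (.n0 (.n1 (.lf 3) (.lf 3)) (.lf 3)) (.n0 (.lf 3) (.lf 3)))) (.n0 (.n2 (.n0 (.lf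 3) (.lf 3)) (.lf 3)) (.n1 (.n0 (.lf 3) (.lf 3)) (.n2 (.n0 (.lf 3) (.lf 3)) (.lf 3)))))) (.n1 (.n1 (.lf 3) (.n0 (.n0 (.lf 3) (.lf 3)) (.lf 3))) (.n2 (.n0 (.lf 3) (.lf 3)) (.lf 3)))) (.n0 (.n0 (.n2 (.n0 (.lf 3) (.n1 (.lf 3) (.n0 (.n2 (.lf 3) (.lf 3)) (.n2 (.lf 3) (.lf 3))))) (.n1 (.n0 (.n1 (.lf 3) (.lf 3)) (.n1 (.lf 3) (.lf 3))) (.n0 (.lf 3) (.lf 3)))) (.n2 (.n1 (.n0 (.n2 (.n0 (.lf 3) (.lf 3)) (.n0 (.lf 3) (.lf 3))) (.lf 3)) (.n2 (.lf 3) (.lf 3))) (.lf 3))) (.lf 3))))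
def aT : List (List ℤ) := [[1],
[1, -1],
[3, -6, 1],
[15, -45, 15, -1],
[105, -420, 210, -28, 1],
[945, -4725, 3150, -630, 45, -1],
[10395, -62370, 51975, -13860, 1485, -66, 1],
[135135, -945945, 945945, -315315, 45045, -3003, 91, -1],
[2027025, -16216200, 18918900, -7567560, 1351350, -120120, 5460, -120, 1],
[34459425, -310134825, 413513100, -192972780, 41351310, -4594590, 278460, -9180, 153, -1],
[654729075, -6547290750, 9820936125, -5237832600, 1309458150, -174594420, 13226850, -581400, 14535, -190, 1],
[13749310575, -151242416325, 252070693875, -151242416325, 43212118950, -6721885170, 611080470, -33575850, 1119195, -21945, 231, -1]]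

def get1 (l : List ℕ) (n : ℕ) : ℕ := l.getD n 0
def get2 (l : List (List ℕ)) (n m : ℕ) : ℕ := get1 (l.getD n []) m
def get3 (l : Tab) (n m k : ℕ) : ℕ := get2 (l.getD n []) m k
/-- signed coefficient -/
def cf (tp tn : Tab) (i j k : ℕ) : ℤ := (get3 tp (i + j + k) (j + k) k : ℤ) - get3 tn (i + j + k) (j + k) k
def ai (i m : ℕ) : ℤ := (aT.getD i []).getD m 0
def sm (f : ℕ → ℤ) (n : ℕ) : ℤ := Nat.rec 0 (fun k s => s + f k) n

lemma sP1 : tsum3 tPp ≤ sP := by decide +kernel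
lemma sP2 : tsum3 tPn ≤ sP := by decide +kernel
lemma sH1 : tsum3 tHp ≤ sH := by decide +kernel
lemma sH2 : tsum3 tHn ≤ sH := by decide +kernel
lemma trH_pure : trH.pure = true := by decide +kernel
def shape (t : Tab) : Bool := t.length ≤ 12 && (List.range 12).all fun n =>
  (t.getD n []).length ≤ n + 1 && (List.range 12).all fun l => ((t.getD n []).getD l []).length ≤ l + 1
lemma shP : shape tPp = true := by decide +kernel
lemma shPn : shape tPn = true := by decide +kernel
lemma shH : shape tHp = true := by decide +kernel
lemma shHn : shape tHn = true := by decide +kernel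
lemma symP : ∀ i < 12, ∀ j < 12, ∀ k < 12, cf tPp tPn i j k = cf tPp tPn j i k ∧
    cf tPp tPn i j k = cf tPp tPn i k j := by decide +kernel
lemma symH : ∀ i < 12, ∀ j < 12, ∀ k < 12, cf tHp tHn i j k = cf tHp tHn j i k ∧
    cf tHp tHn i j k = cf tHp tHn i k j := by decide +kernel
lemma aT_zero : ∀ m < 13, ai 0 m = if m = 0 then 1 else 0 := by decide +kernel
lemma aT_succ : ∀ i < 11, ∀ m < 13, ai (i + 1) m = (4 * m + 1) * ai i m - (if m = 0 then 0 else ai i (m - 1))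
    - (4 * m * (m + 1) + 2 * (m + 1)) * ai i (m + 1) := by decide +kernel

lemma link : ∀ m < 12, ∀ n < 12 - m, ∀ p < 12 - m - n, 12 ^ 11 * cf tPp tPn m n p =
    - sm (fun i => ai (m + i) m * sm (fun j => ai (n + j) n * sm (fun k => ai (p + k) p *
       (12 ^ (11 - i - j - k) * cf tHp tHn (m + i) (n + j) (p + k)))
       (12 - m - n - p - i - j)) (12 - m - n - p - i)) (12 - m - n - p) := by decide +kernel

set_option maxRecDepth 100000 in
lemma chkH : chk tHp tHn sH trH ⟨1, 0, 0, 1⟩ ⟨1, 0, 1, 1⟩ ⟨1, 0, 1, 1⟩ = true := by decide +kernel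
set_option maxRecDepth 100000 in
lemma chkP : chk tPp tPn sP trP ⟨1, 0, 0, 1⟩ ⟨1, 0, 1, 1⟩ ⟨1, 0, 1, 1⟩ = true := by decide +kernel


/-- polynomial from coefficients -/
noncomputable def PL (D : ℕ → ℕ → ℕ → ℝ) (y1 y2 y3 : ℝ) : ℝ :=
  ∑ i ∈ Finset.range 12, ∑ j ∈ Finset.range 12, ∑ k ∈ Finset.range 12, D i j k * (y1 ^ i * y2 ^ j * y3 ^ k)

lemma ev1_get {R : Type*} [CommSemiring R] (l : List ℕ) (N : ℕ) (f : ℕ → R) (hf : l.length ≤ N) :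
    ev1 l f = ∑ n ∈ Finset.range N, (get1 l n : R) * f n := by
  induction l generalizing N f with
  | nil => simp [ev1, get1]
  | cons a l ih =>
    cases N with
    | zero => simp at hf
    | succ N =>
      rw [Finset.sum_range_succ', ev1, ih N _ (by simpa using hf), add_comm]
      simp [get1]

lemma ev2_get {R : Type*} [CommSemiring R] (C : ℕ → R) (l : List (List ℕ)) (N : ℕ) (f : ℕ → R) (hf : l.length ≤ N) :
    ev2 C l f = ∑ n ∈ Finset.range N, ev1 (l.getD n []) C * f n := by
  induction l generalizing N f with
  | nil => simp [ev2, ev1]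
  | cons a l ih =>
    cases N with
    | zero => simp at hf
    | succ N =>
      rw [Finset.sum_range_succ', ev2, ih N _ (by simpa using hf), add_comm]
      simp

lemma ev3_get {R : Type*} [CommSemiring R] (B C : ℕ → R) (l : Tab) (N : ℕ) (f : ℕ → R) (hf : l.length ≤ N) :
    ev3 B C l f = ∑ n ∈ Finset.range N, ev2 C (l.getD n []) B * f n := by
  induction l generalizing N f with
  | nil => simp [ev3, ev2]
  | cons a l ih =>
    cases N with
    | zero => simp at hf
    | succ N =>
      rw [Finset.sum_range_succ', ev3, ih N _ (by simpa using hf), add_comm]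
      simp

lemma shape_len (t : Tab) (h : shape t = true) : t.length ≤ 12 ∧ (∀ n < 12, (t.getD n []).length ≤ n + 1) ∧
    ∀ n < 12, ∀ l < 12, ((t.getD n []).getD l []).length ≤ l + 1 := by
  simp only [shape, Bool.and_eq_true, List.all_eq_true, List.mem_range, decide_eq_true_eq] at h
  exact ⟨h.1, fun n hn => (h.2 n hn).1, fun n hn l hl => (h.2 n hn).2 l hl⟩

lemma get3_zero (t : Tab) (h : shape t = true) (n l k : ℕ) (hz : ¬ (k ≤ l ∧ l ≤ n ∧ n < 12)) : get3 t n l k = 0 := by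
  obtain ⟨h1, h2, h3⟩ := shape_len t h
  unfold get3 get2 get1
  by_cases hn : n < 12
  · by_cases hl : l < 12
    · by_cases hln : l ≤ n
      · rw [List.getD_eq_default]; have := h3 n hn l hl; omega
      · rw [List.getD_eq_default (n := l)]; · simp
        have := h2 n hn; omega
    · rw [List.getD_eq_default (n := l)]; · simp
      have := h2 n hn; omega
  · rw [List.getD_eq_default (n := n)]; · simp
    omega

lemma val_get (t : Tab) (h : shape t = true) (y1 y2 y3 : ℝ) (hy1 : y1 ≠ 0) (hy2 : y2 ≠ 0) :
    val t y1 12 y2 y1 y3 y2 = (12 * y1 * y2) ^ 11 *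
      PL (fun i j k => (get3 t (i + j + k) (j + k) k : ℝ) / 12 ^ (i + j + k)) y1 y2 y3 := by
  obtain ⟨h1, h2, h3⟩ := shape_len t h
  have e1 : val t y1 12 y2 y1 y3 y2 = ∑ n ∈ Finset.range 12, ∑ l ∈ Finset.range 12, ∑ k ∈ Finset.range 12,
      (get3 t n l k : ℝ) * (hp y1 12 n * hp y2 y1 l * hp y3 y2 k) := by
    unfold val
    rw [ev3_get _ _ _ 12 _ h1]
    refine Finset.sum_congr rfl fun n hn => ?_
    have hn := Finset.mem_range.1 hn
    rw [ev2_get _ _ 12 _ ((h2 n hn).trans (by omega)), Finset.sum_mul]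
    refine Finset.sum_congr rfl fun l hl => ?_
    have hl := Finset.mem_range.1 hl
    rw [ev1_get _ 12 _ ((h3 n hn l hl).trans (by omega)), Finset.sum_mul, Finset.sum_mul]
    refine Finset.sum_congr rfl fun k _ => ?_
    unfold get3 get2; ring
  rw [e1]
  unfold PL
  simp only [Finset.mul_sum, ← Finset.sum_product']
  rw [← Finset.sum_filter_of_ne (p := fun q : ℕ × ℕ × ℕ => q.2.2 ≤ q.2.1 ∧ q.2.1 ≤ q.1 ∧ q.1 < 12)]
  swap
  · intro q _ hq
    by_contra hc
    exact hq (by rw [get3_zero t h _ _ _ hc]; simp)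
  rw [← Finset.sum_filter_of_ne (s := Finset.range 12 ×ˢ Finset.range 12 ×ˢ Finset.range 12) (p := fun q : ℕ × ℕ × ℕ => q.1 + q.2.1 + q.2.2 < 12)]
  swap
  · intro q _ hq
    by_contra hc
    exact hq (by rw [get3_zero t h _ _ _ (by omega)]; simp)
  refine Finset.sum_nbij' (fun q => (q.1 - q.2.1, q.2.1 - q.2.2, q.2.2))
    (fun q => (q.1 + q.2.1 + q.2.2, q.2.1 + q.2.2, q.2.2)) ?_ ?_ ?_ ?_ ?_
  · rintro ⟨n, l, k⟩ hq; simp at hq ⊢; omega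
  · rintro ⟨n, l, k⟩ hq; simp at hq ⊢; omega
  · rintro ⟨n, l, k⟩ hq; simp at hq ⊢; omega
  · rintro ⟨n, l, k⟩ hq; simp at hq ⊢; omega
  · rintro ⟨n, l, k⟩ hq
    simp only [Finset.mem_filter, Finset.mem_product, Finset.mem_range] at hq
    obtain ⟨-, hkl, hln, hn⟩ := hq
    simp only
    obtain ⟨j, rfl⟩ := Nat.exists_eq_add_of_le hkl
    obtain ⟨i, rfl⟩ := Nat.exists_eq_add_of_le hln
    have q1 : k + j + i - (k + j) = i := by omega
    have q2 : k + j - k = j := by omega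
    have q3 : i + j + k = k + j + i := by omega
    have q4 : j + k = k + j := by omega
    rw [q1, q2, q3, q4]
    have p1 : k + j + i < 12 := hn
    have p2 : k + j < 12 := by omega
    have p3 : k < 12 := by omega
    simp only [hp, p1, p2, p3, if_true]
    obtain ⟨r, hr⟩ := Nat.exists_eq_add_of_le (show k + j + i ≤ 11 by omega)
    have r1 : 11 - (k + j + i) = r := by omega
    have r2 : 11 - (k + j) = r + i := by omega
    have r3 : 11 - k = r + i + j := by omega
    have hr' : (12 * y1 * y2) ^ 11 = (12 * y1 * y2) ^ (k + j + i + r) := congrArg _ hr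
    rw [r1, r2, r3, hr']
    field_simp
    ring

noncomputable def CP (i j k : ℕ) : ℝ := (cf tPp tPn i j k : ℝ) / 12 ^ (i + j + k)
noncomputable def CH (i j k : ℕ) : ℝ := - (cf tHp tHn i j k : ℝ) / 12 ^ (i + j + k)

lemma PL_sub (f g h : ℕ → ℕ → ℕ → ℝ) (e : ∀ i j k, f i j k = g i j k - h i j k) (a b c : ℝ) :
    PL f a b c = PL g a b c - PL h a b c := by
  unfold PL
  simp only [← Finset.sum_sub_distrib]
  refine Finset.sum_congr rfl fun i _ => Finset.sum_congr rfl fun j _ =>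
        Finset.sum_congr rfl fun k _ => ?_
  rw [e]; ring

lemma PL_symm12 (f : ℕ → ℕ → ℕ → ℝ) (e : ∀ i < 12, ∀ j < 12, ∀ k < 12, f i j k = f j i k) (a b c : ℝ) :
    PL f a b c = PL f b a c := by
  unfold PL
  rw [Finset.sum_comm]
  refine Finset.sum_congr rfl fun i hi => Finset.sum_congr rfl fun j hj =>
        Finset.sum_congr rfl fun k hk => ?_
  rw [e j (Finset.mem_range.1 hj) i (Finset.mem_range.1 hi) k (Finset.mem_range.1 hk)]; ring

lemma PL_symm23 (f : ℕ → ℕ → ℕ → ℝ) (e : ∀ i < 12, ∀ j < 12, ∀ k < 12, f i j k = f i k j) (a b c : ℝ) :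
    PL f a b c = PL f a c b := by
  unfold PL
  refine Finset.sum_congr rfl fun i hi => ?_
  rw [Finset.sum_comm]
  refine Finset.sum_congr rfl fun j hj => Finset.sum_congr rfl fun k hk => ?_
  rw [e i (Finset.mem_range.1 hi) k (Finset.mem_range.1 hk) j (Finset.mem_range.1 hj)]; ring

lemma PL_cont (f : ℕ → ℕ → ℕ → ℝ) (a b c : ℝ) : Continuous fun ε : ℝ => PL f (a + ε) (b + ε) (c + ε) := by
  unfold PL; fun_prop

/-- sorting and perturbing -/
lemma sortpert (f : ℕ → ℕ → ℕ → ℝ) (s12 : ∀ i < 12, ∀ j < 12, ∀ k < 12, f i j k = f j i k)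
    (s23 : ∀ i < 12, ∀ j < 12, ∀ k < 12, f i j k = f i k j) (M : ℝ)
    (H : ∀ a b c : ℝ, 0 < c → c ≤ b → b ≤ a → M < 9 * (a ^ 2 + b ^ 2 + c ^ 2) → PL f a b c ≤ 0)
    (a b c : ℝ) (ha : 0 ≤ a) (hb : 0 ≤ b) (hc : 0 ≤ c) (hM : M ≤ 9 * (a ^ 2 + b ^ 2 + c ^ 2)) :
    PL f a b c ≤ 0 := by
  have H1 : ∀ a b c : ℝ, 0 ≤ c → c ≤ b → b ≤ a → M ≤ 9 * (a ^ 2 + b ^ 2 + c ^ 2) → PL f a b c ≤ 0 := by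
    intro a b c hc hcb hba hM
    have ht : Filter.Tendsto (fun ε : ℝ => PL f (a + ε) (b + ε) (c + ε)) (nhdsWithin 0 (Set.Ioi 0)) (nhds (PL f a b c)) := by
      have := (PL_cont f a b c).tendsto 0
      simp only [add_zero] at this
      exact this.mono_left nhdsWithin_le_nhds
    refine le_of_tendsto ht ?_
    filter_upwards [self_mem_nhdsWithin] with ε hε
    have hε : 0 < ε := hε
    refine H _ _ _ (by linarith) (by linarith) (by linarith) ?_
    have : 0 ≤ b := hc.trans hcb
    nlinarith
  have t12 := PL_symm12 f s12
  have t23 := PL_symm23 f s23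
  rcases le_total a b with h1 | h1 <;> rcases le_total b c with h2 | h2 <;> rcases le_total a c with h3 | h3
  · rw [t12, t23, t12]; exact H1 _ _ _ ha h1 h2 (by linarith)
  · rw [t12, t23, t12]; exact H1 _ _ _ ha h1 h2 (by linarith)
  · rw [t12, t23]; exact H1 _ _ _ ha h3 h2 (by linarith)
  · rw [t12]; exact H1 _ _ _ hc h3 h1 (by linarith)
  · rw [t23, t12]; exact H1 _ _ _ hb h1 h3 (by linarith)
  · rw [t23]; exact H1 _ _ _ hb h2 h3 (by linarith)
  · exact H1 _ _ _ hc h2 h1 (by linarith)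
  · exact H1 _ _ _ hc h2 h1 (by linarith)

lemma core (tp tn : Tab) (S : ℕ) (t : Tr) (h1 : shape tp = true) (h2 : shape tn = true)
    (s1 : tsum3 tp ≤ S) (s2 : tsum3 tn ≤ S)
    (hc : chk tp tn S t ⟨1, 0, 0, 1⟩ ⟨1, 0, 1, 1⟩ ⟨1, 0, 1, 1⟩ = true)
    (a b c : ℝ) (c0 : 0 < c) (cb : c ≤ b) (ba : b ≤ a)
    (hq : t.pure = true ∨ 400 < 9 * (a ^ 2 + b ^ 2 + c ^ 2)) :
    PL (fun i j k => (cf tp tn i j k : ℝ) / 12 ^ (i + j + k)) a b c ≤ 0 := by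
  have b0 : 0 < b := c0.trans_le cb
  have a0 : 0 < a := b0.trans_le ba
  have hQ : t.pure = true ∨ val qn a 12 b a c b < val qp a 12 b a c b := by
    refine hq.imp_right fun hq => ?_
    have : val qp a 12 b a c b - val qn a 12 b a c b = (12 * a * b) ^ 11 * (9 * (a ^ 2 + b ^ 2 + c ^ 2) - 400) := by
      simp [val, qp, qn, ev3, ev2, ev1, hp]; ring
    have h3 : 0 < (12 * a * b) ^ 11 * (9 * (a ^ 2 + b ^ 2 + c ^ 2) - 400) :=
      mul_pos (by positivity) (by linarith)
    linarith
  have key := chk_sound tp tn S s1 s2 a 12 b a c b t hQ _ _ _ hc a 12 b (a - b) c (b - c)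
    a0.le (by norm_num) b0.le (by linarith) c0.le (by linarith)
    (by simp) (by simp) (by simp) (by simp) (by simp) (by simp)
  rw [val_get tp h1 _ _ _ a0.ne' b0.ne', val_get tn h2 _ _ _ a0.ne' b0.ne'] at key
  have := le_of_mul_le_mul_left key (by positivity)
  rw [PL_sub _ (fun i j k => (get3 tp (i + j + k) (j + k) k : ℝ) / 12 ^ (i + j + k))
    (fun i j k => (get3 tn (i + j + k) (j + k) k : ℝ) / 12 ^ (i + j + k))]
  · linarith
  · intro i j k; unfold cf; push_cast; ring

theorem H1 (a b c : ℝ) (ha : 0 ≤ a) (hb : 0 ≤ b) (hc : 0 ≤ c) (hM : 400 ≤ 9 * (a ^ 2 + b ^ 2 + c ^ 2)) :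
    PL CP a b c ≤ 0 := by
  refine sortpert CP ?_ ?_ 400 ?_ a b c ha hb hc hM
  · intro i hi j hj k hk; unfold CP; rw [(symP i hi j hj k hk).1, add_comm i j]
  · intro i hi j hj k hk; unfold CP; rw [(symP i hi j hj k hk).2, add_right_comm i j]
  · intro a b c c0 cb ba hq
    exact core tPp tPn sP trP shP shPn sP1 sP2 chkP a b c c0 cb ba (Or.inr hq)

theorem H2 (a b c : ℝ) (ha : 0 ≤ a) (hb : 0 ≤ b) (hc : 0 ≤ c) : 0 ≤ PL CH a b c := by
  have := sortpert (fun i j k => (cf tHp tHn i j k : ℝ) / 12 ^ (i + j + k)) ?_ ?_ (-1) ?_ a b c ha hb hc ?_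
  · have e := PL_sub CH (fun _ _ _ => 0) (fun i j k => (cf tHp tHn i j k : ℝ) / 12 ^ (i + j + k))
      (fun i j k => by unfold CH; ring) a b c
    rw [e]; simp [PL] at this ⊢; exact this
  · intro i hi j hj k hk; rw [(symH i hi j hj k hk).1, add_comm i j]
  · intro i hi j hj k hk; rw [(symH i hi j hj k hk).2, add_right_comm i j]
  · intro a b c c0 cb ba hq
    exact core tHp tHn sH trH shH shHn sH1 sH2 chkH a b c c0 cb ba (Or.inl trH_pure)
  · have : 0 ≤ 9 * (a ^ 2 + b ^ 2 + c ^ 2) := by positivity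
    linarith


lemma sm_eq (f : ℕ → ℤ) (n : ℕ) : sm f n = ∑ k ∈ Finset.range n, f k := by
  induction n with
  | zero => rfl
  | succ n ih => rw [Finset.sum_range_succ, ← ih]; rfl

lemma ai_zero : ∀ i < 12, ∀ m < 12, i < m → ai i m = 0 := by decide +kernel

lemma shift (f : ℕ → ℝ) (m N : ℕ) (h : m + N ≤ 12) (h1 : ∀ i < m, f i = 0) (h2 : ∀ i < 12, m + N ≤ i → f i = 0) :
    ∑ i ∈ Finset.range 12, f i = ∑ i ∈ Finset.range N, f (m + i) := by
  have e : 12 = m + (N + (12 - m - N)) := by omega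
  rw [e, Finset.sum_range_add, Finset.sum_range_add, Finset.sum_eq_zero (s := Finset.range m),
    Finset.sum_eq_zero (s := Finset.range (12 - m - N))]
  · simp
  · intro i hi; have := Finset.mem_range.1 hi
    exact h2 _ (by omega) (by omega)
  · intro i hi; exact h1 _ (Finset.mem_range.1 hi)

lemma CH_zero (i j k : ℕ) (h : 12 ≤ i + j + k) : CH i j k = 0 := by
  unfold CH cf
  rw [get3_zero _ shH _ _ _ (by omega), get3_zero _ shHn _ _ _ (by omega)]; simp

lemma CP_eq (m n p : ℕ) (hm : m < 12) (hn : n < 12) (hp : p < 12) : CP m n p =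
    ∑ i ∈ Finset.range 12, (ai i m : ℝ) * ∑ j ∈ Finset.range 12, (ai j n : ℝ) *
      ∑ k ∈ Finset.range 12, (ai k p : ℝ) * CH i j k := by
  have az : ∀ i < 12, ∀ m < 12, i < m → (ai i m : ℝ) = 0 := fun i hi m hm h => by rw [ai_zero i hi m hm h]; simp
  have k0 : ∀ i < 12, ∀ j < 12, 12 ≤ i + j + p → ∑ k ∈ Finset.range 12, (ai k p : ℝ) * CH i j k = 0 := by
    intro i hi j hj h
    refine Finset.sum_eq_zero fun k hk => ?_
    have hk := Finset.mem_range.1 hk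
    by_cases hkp : k < p
    · rw [az k hk p hp hkp, zero_mul]
    · rw [CH_zero _ _ _ (by omega), mul_zero]
  have j0 : ∀ i < 12, 12 ≤ i + n + p → ∑ j ∈ Finset.range 12, (ai j n : ℝ) * ∑ k ∈ Finset.range 12, (ai k p : ℝ) * CH i j k = 0 := by
    intro i hi h
    refine Finset.sum_eq_zero fun j hj => ?_
    have hj := Finset.mem_range.1 hj
    by_cases hkp : j < n
    · rw [az j hj n hn hkp, zero_mul]
    · rw [k0 _ hi _ hj (by omega), mul_zero]
  by_cases hs : m + n + p < 12
  · have hl := link m hm n (by omega) p (by omega)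
    have hl' : (12 : ℝ) ^ 11 * cf tPp tPn m n p = ((12 ^ 11 * cf tPp tPn m n p : ℤ) : ℝ) := by push_cast; ring
    have e : CP m n p = ((12 : ℝ) ^ 11 * cf tPp tPn m n p) / (12 ^ 11 * 12 ^ (m + n + p)) := by
      unfold CP; field_simp
    rw [e, hl', hl]
    simp only [sm_eq, Int.cast_neg, Int.cast_sum, Int.cast_mul]
    rw [shift _ m (12 - m - n - p) (by omega) (fun i hi => by rw [az i (by omega) m hm hi, zero_mul])
      (fun i hi h => by rw [j0 i hi (by omega), mul_zero])]
    rw [← Finset.sum_neg_distrib, Finset.sum_div]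
    refine Finset.sum_congr rfl fun i hi => ?_
    have hi := Finset.mem_range.1 hi
    rw [shift _ n (12 - m - n - p - i) (by omega) (fun j hj => by rw [az j (by omega) n hn hj, zero_mul])
      (fun j hj h => by rw [k0 (m + i) (by omega) j hj (by omega), mul_zero])]
    rw [Finset.mul_sum, Finset.mul_sum, ← Finset.sum_neg_distrib, Finset.sum_div]
    refine Finset.sum_congr rfl fun j hj => ?_
    have hj := Finset.mem_range.1 hj
    rw [shift _ p (12 - m - n - p - i - j) (by omega) (fun k hk => by rw [az k (by omega) p hp hk, zero_mul])
      (fun k hk h => by rw [CH_zero _ _ _ (by omega), mul_zero])]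
    simp only [Finset.mul_sum]
    rw [← Finset.sum_neg_distrib, Finset.sum_div]
    refine Finset.sum_congr rfl fun k hk => ?_
    have hk := Finset.mem_range.1 hk
    unfold CH
    obtain ⟨r, hr⟩ := Nat.exists_eq_add_of_le (show i + j + k ≤ 11 by omega)
    have r1 : 11 - i - j - k = r := by omega
    have r2 : (12 : ℝ) ^ 11 = 12 ^ (i + j + k + r) := congrArg _ hr
    rw [r1, r2]
    push_cast
    field_simp
    ring
  · have : CP m n p = 0 := by
      unfold CP cf
      rw [get3_zero _ shP _ _ _ (by omega), get3_zero _ shPn _ _ _ (by omega)]; simp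
    rw [this]; symm
    refine Finset.sum_eq_zero fun i hi => ?_
    have hi := Finset.mem_range.1 hi
    by_cases him : i < m
    · rw [az i hi m hm him, zero_mul]
    · rw [j0 i hi (by omega), mul_zero]

/-- the polynomials `a_i` -/
noncomputable def aP (i : ℕ) (y : ℝ) : ℝ := ∑ m ∈ Finset.range 12, (ai i m : ℝ) * y ^ m

lemma PL_link (y1 y2 y3 : ℝ) : PL CP y1 y2 y3 =
    ∑ i ∈ Finset.range 12, ∑ j ∈ Finset.range 12, ∑ k ∈ Finset.range 12, CH i j k * (aP i y1 * aP j y2 * aP k y3) := by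
  -- one variable at a time
  have L : ∀ (F : ℕ → ℝ) (y : ℝ), ∑ m ∈ Finset.range 12, (∑ i ∈ Finset.range 12, (ai i m : ℝ) * F i) * y ^ m =
      ∑ i ∈ Finset.range 12, F i * aP i y := by
    intro F y
    simp only [aP, Finset.sum_mul, Finset.mul_sum]
    rw [Finset.sum_comm]
    refine Finset.sum_congr rfl fun i _ => Finset.sum_congr rfl fun m _ => ?_
    ring
  have e1 : PL CP y1 y2 y3 = ∑ m ∈ Finset.range 12, (∑ i ∈ Finset.range 12, (ai i m : ℝ) *
      ∑ n ∈ Finset.range 12, (∑ j ∈ Finset.range 12, (ai j n : ℝ) *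
      ∑ p ∈ Finset.range 12, (∑ k ∈ Finset.range 12, (ai k p : ℝ) * CH i j k) * y3 ^ p) * y2 ^ n) * y1 ^ m := by
    unfold PL
    refine Finset.sum_congr rfl fun m hm => ?_
    have hm := Finset.mem_range.1 hm
    have : ∀ n ∈ Finset.range 12, ∀ p ∈ Finset.range 12, CP m n p * (y1 ^ m * y2 ^ n * y3 ^ p) =
      (∑ i ∈ Finset.range 12, (ai i m : ℝ) * ((∑ j ∈ Finset.range 12, (ai j n : ℝ) *
      ((∑ k ∈ Finset.range 12, (ai k p : ℝ) * CH i j k) * y3 ^ p)) * y2 ^ n)) * y1 ^ m := by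
      intro n hn p hp
      rw [CP_eq m n p hm (Finset.mem_range.1 hn) (Finset.mem_range.1 hp)]
      simp only [Finset.sum_mul, Finset.mul_sum]
      refine Finset.sum_congr rfl fun i _ => Finset.sum_congr rfl fun j _ => Finset.sum_congr rfl fun k _ => ?_
      ring
    rw [Finset.sum_congr rfl fun n hn => Finset.sum_congr rfl (this n hn)]
    simp only [← Finset.sum_mul]
    congr 1
    have c1 : ∀ n, ∑ p ∈ Finset.range 12, ∑ i ∈ Finset.range 12, (ai i m : ℝ) * ((∑ j ∈ Finset.range 12, (ai j n : ℝ) *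
      ((∑ k ∈ Finset.range 12, (ai k p : ℝ) * CH i j k) * y3 ^ p)) * y2 ^ n) = 
      ∑ i ∈ Finset.range 12, (ai i m : ℝ) * ((∑ j ∈ Finset.range 12, (ai j n : ℝ) *
      ∑ p ∈ Finset.range 12, ((∑ k ∈ Finset.range 12, (ai k p : ℝ) * CH i j k) * y3 ^ p)) * y2 ^ n) := by
      intro n
      rw [Finset.sum_comm]
      refine Finset.sum_congr rfl fun i _ => ?_
      rw [← Finset.mul_sum, ← Finset.sum_mul, Finset.sum_comm]
      simp only [Finset.mul_sum]
    simp only [c1]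
    rw [Finset.sum_comm]
    simp only [Finset.mul_sum]
  rw [e1]
  simp only [L]
  simp only [Finset.sum_mul]
  refine Finset.sum_congr rfl fun i _ => Finset.sum_congr rfl fun j _ => Finset.sum_congr rfl fun k _ => ?_
  ring


section fourier
open Polynomial FourierTransform Filter Asymptotics MeasureTheory

/-- polynomial times Gaussian -/
noncomputable def pg (c : ℝ) (q : ℝ[X]) (x : ℝ) : ℂ := ((q.eval x * Real.exp (-c * x ^ 2) : ℝ) : ℂ)

lemma pg_cont (c : ℝ) (q : ℝ[X]) : Continuous (pg c q) := by
  unfold pg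
  exact Complex.continuous_ofReal.comp (q.continuous.mul (by fun_prop))

lemma pg_deriv (c : ℝ) (q : ℝ[X]) (x : ℝ) :
    HasDerivAt (pg c q) (pg c (derivative q - C (2 * c) * X * q) x) x := by
  unfold pg
  apply HasDerivAt.ofReal_comp
  have h1 := q.hasDerivAt x
  have h2 : HasDerivAt (fun x : ℝ => Real.exp (-c * x ^ 2)) (Real.exp (-c * x ^ 2) * (-c * (2 * x))) x := by
    have := ((hasDerivAt_pow 2 x).const_mul (-c)).exp
    simpa using this
  have h3 := h1.mul h2
  refine h3.congr_deriv ?_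
  simp only [eval_sub, eval_mul, eval_C, eval_X]
  ring

lemma pg_add (c : ℝ) (p q : ℝ[X]) : pg c (p + q) = fun x => pg c p x + pg c q x := by
  ext x; unfold pg; rw [eval_add]; push_cast; ring

lemma pg_O (c : ℝ) (hc : 0 < c) (q : ℝ[X]) : pg c q =O[cocompact ℝ] fun x : ℝ => |x| ^ (-2 : ℝ) := by
  induction q using Polynomial.induction_on' with
  | add p q hp hq => rw [pg_add]; exact hp.add hq
  | monomial n a =>
    have h1 : (fun x : ℝ => Complex.exp (-(c : ℂ) * x ^ 2)) =O[cocompact ℝ] fun x : ℝ => |x| ^ (-2 - n : ℝ) :=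
      (isLittleO_exp_neg_mul_sq_cocompact (a := (c : ℂ)) (by simpa using hc) (-2 - n)).isBigO
    have h2 : (fun x : ℝ => ((a * x ^ n : ℝ) : ℂ)) =O[cocompact ℝ] fun x : ℝ => |x| ^ n := by
      refine IsBigO.of_bound |a| (Eventually.of_forall fun x => ?_)
      simp
    refine (h2.mul h1).congr' ?_ ?_
    · refine Eventually.of_forall fun x => ?_
      simp [pg]
    · filter_upwards [(isCompact_singleton (x := (0 : ℝ))).compl_mem_cocompact] with x hx
      have hx : 0 < |x| := abs_pos.2 (Set.mem_compl_singleton_iff.1 hx)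
      rw [← Real.rpow_natCast, ← Real.rpow_add hx]
      congr 1; ring

lemma pg_int (c : ℝ) (hc : 0 < c) (q : ℝ[X]) : Integrable (pg c q) := by
  induction q using Polynomial.induction_on' with
  | add p q hp hq => rw [pg_add]; exact hp.add hq
  | monomial n a =>
    have := (integrable_rpow_mul_exp_neg_mul_sq hc (s := n) (by have := Nat.cast_nonneg (α := ℝ) n; linarith)).const_mul a
    have h2 := this.ofReal (𝕜 := ℂ)
    refine h2.congr (Eventually.of_forall fun x => ?_)
    simp [pg]; ring

/-- polynomial in `x` for `a_i (β x^2)` -/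
noncomputable def qP (β : ℝ) (i : ℕ) : ℝ[X] := ∑ m ∈ Finset.range 12, C ((ai i m : ℝ) * β ^ m) * X ^ (2 * m)

lemma qP_eval (β : ℝ) (i : ℕ) (x : ℝ) : (qP β i).eval x = aP i (β * x ^ 2) := by
  simp only [qP, aP, eval_finsetSum]
  refine Finset.sum_congr rfl fun m _ => ?_
  simp; ring

lemma qP_succ (β : ℝ) (i : ℕ) (hi : i < 11) :
    derivative (derivative (qP β i) - C β * X * qP β i) - C β * X * (derivative (qP β i) - C β * X * qP β i)
      = - C β * qP β (i + 1) := by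
  have hm : ∀ m, derivative (derivative (C ((ai i m : ℝ) * β ^ m) * X ^ (2 * m)) - C β * X * (C ((ai i m : ℝ) * β ^ m) * X ^ (2 * m))) - C β * X * (derivative (C ((ai i m : ℝ) * β ^ m) * X ^ (2 * m)) - C β * X * (C ((ai i m : ℝ) * β ^ m) * X ^ (2 * m)))
    = C ((ai i m : ℝ) * β ^ m * (2 * m * (2 * m - 1))) * X ^ (2 * m - 2)
     - C ((ai i m : ℝ) * β ^ m * (β * (4 * m + 1))) * X ^ (2 * m)
     + C ((ai i m : ℝ) * β ^ m * β ^ 2) * X ^ (2 * m + 2) := by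
    intro m
    generalize (ai i m : ℝ) * β ^ m = K
    rcases m with _ | m
    · simp only [derivative_sub, derivative_add, derivative_zero, derivative_mul, derivative_C, derivative_X, pow_zero, derivative_one, C_mul, C_add, C_pow, Nat.cast_zero, C_0, mul_zero, zero_mul, C_1]
      ring
    · have e1 : 2 * (m + 1) - 2 = 2 * m := by omega
      have e2 : 2 * (m + 1) - 1 = 2 * m + 1 := by omega
      have e3 : 2 * m + 1 - 1 = 2 * m := by omega
      have c2 : (C (2 : ℝ) : ℝ[X]) = 2 := rfl
      have c4 : (C (4 : ℝ) : ℝ[X]) = 4 := rfl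
      have cn : ∀ n : ℕ, (C (n : ℝ) : ℝ[X]) = n := by simp
      simp only [derivative_sub, derivative_add, derivative_zero, derivative_mul, derivative_C, derivative_X, derivative_X_pow, e1, e2, e3]
      simp only [C_mul, C_pow, C_sub, C_add, C_1, c2, c4, cn]
      push_cast
      ring
  have hsum : derivative (derivative (qP β i) - C β * X * qP β i) - C β * X * (derivative (qP β i) - C β * X * qP β i) =
     ∑ m ∈ Finset.range 12, (C ((ai i m : ℝ) * β ^ m * (2 * m * (2 * m - 1))) * X ^ (2 * m - 2)
     - C ((ai i m : ℝ) * β ^ m * (β * (4 * m + 1))) * X ^ (2 * m)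
     + C ((ai i m : ℝ) * β ^ m * β ^ 2) * X ^ (2 * m + 2)) := by
    rw [← Finset.sum_congr rfl fun m _ => hm m]
    unfold qP
    simp only [derivative_sum, Finset.mul_sum, mul_sub, Finset.sum_sub_distrib, derivative_sub]
  have z11 : (ai i 11 : ℝ) = 0 := by rw [ai_zero i (by omega) 11 (by omega) (by omega)]; simp
  have z12 : (ai i 12 : ℝ) = 0 := by
    have : ∀ i < 12, ai i 12 = 0 := by decide +kernel
    rw [this i (by omega)]; simp
  rw [hsum, Finset.sum_add_distrib, Finset.sum_sub_distrib]
  rw [Finset.sum_range_succ' (fun m => C ((ai i m : ℝ) * β ^ m * (2 * m * (2 * m - 1))) * X ^ (2 * m - 2)),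
    Finset.sum_range_succ (fun m => C ((ai i m : ℝ) * β ^ m * β ^ 2) * X ^ (2 * m + 2))]
  have hA : ∀ m ∈ Finset.range 12, C ((ai (i + 1) m : ℝ) * β ^ m) * (X : ℝ[X]) ^ (2 * m) =
      C ((ai i m : ℝ) * β ^ m * (4 * m + 1)) * X ^ (2 * m)
      - C ((if m = 0 then 0 else (ai i (m - 1) : ℝ)) * β ^ m) * X ^ (2 * m)
      - C ((ai i (m + 1) : ℝ) * β ^ m * ((2 * m + 2) * (2 * m + 1))) * X ^ (2 * m) := by
    intro m hm
    rw [aT_succ i hi m (by have := Finset.mem_range.1 hm; omega), ← sub_mul, ← sub_mul, ← C_sub, ← C_sub]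
    congr 2
    split_ifs <;> push_cast <;> ring
  unfold qP
  rw [Finset.sum_congr rfl hA, Finset.sum_sub_distrib, Finset.sum_sub_distrib,
    Finset.sum_range_succ (fun m => C ((ai i (m + 1) : ℝ) * β ^ m * ((2 * m + 2) * (2 * m + 1))) * (X : ℝ[X]) ^ (2 * m)),
    Finset.sum_range_succ' (fun m => C ((if m = 0 then 0 else (ai i (m - 1) : ℝ)) * β ^ m) * (X : ℝ[X]) ^ (2 * m))]
  rw [z11, z12]
  simp only [Nat.add_eq_zero_iff, one_ne_zero, and_false, if_false, Nat.add_sub_cancel, if_true, zero_mul, C_0, add_zero]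
  rw [mul_sub (-C β), mul_sub (-C β), Finset.mul_sum, Finset.mul_sum, Finset.mul_sum]
  have t1 : ∀ m ∈ Finset.range 11, C ((ai i (m + 1) : ℝ) * β ^ (m + 1) * (2 * (m + 1 : ℕ) * (2 * (m + 1 : ℕ) - 1))) * (X : ℝ[X]) ^ (2 * (m + 1) - 2)
      = - (-C β * (C ((ai i (m + 1) : ℝ) * β ^ m * ((2 * m + 2) * (2 * m + 1))) * X ^ (2 * m))) := by
    intro m _
    rw [show 2 * (m + 1) - 2 = 2 * m by omega]
    rw [neg_mul, neg_neg, ← mul_assoc (C β), ← C_mul]; congr 2; push_cast; ring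
  have t2 : ∀ m ∈ Finset.range 12, C ((ai i m : ℝ) * β ^ m * (β * (4 * m + 1))) * (X : ℝ[X]) ^ (2 * m) = -(-C β * (C ((ai i m : ℝ) * β ^ m * (4 * m + 1)) * X ^ (2 * m))) := by
    intro m _
    rw [neg_mul, neg_neg, ← mul_assoc (C β), ← C_mul]; congr 2; ring
  have t3 : ∀ m ∈ Finset.range 11, C ((ai i m : ℝ) * β ^ m * β ^ 2) * (X : ℝ[X]) ^ (2 * m + 2) = -(-C β * (C ((ai i m : ℝ) * β ^ (m + 1)) * X ^ (2 * (m + 1)))) := by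
    intro m _
    rw [neg_mul, neg_neg, ← mul_assoc (C β), ← C_mul, show 2 * (m + 1) = 2 * m + 2 by omega]; congr 2; ring
  rw [Finset.sum_congr rfl t1, Finset.sum_congr rfl t2, Finset.sum_congr rfl t3]
  simp only [Finset.sum_neg_distrib]
  simp
  ring

/-- the one-dimensional functions and their transforms -/
noncomputable def hh (β : ℝ) (i : ℕ) (x : ℝ) : ℝ := aP i (β * x ^ 2) * Real.exp (-(β / 2) * x ^ 2)
noncomputable def hF (β : ℝ) (i : ℕ) (ξ : ℝ) : ℝ :=
  Real.sqrt (2 * Real.pi / β) * ((4 * Real.pi ^ 2 / β * ξ ^ 2) ^ i * Real.exp (-(2 * Real.pi ^ 2 / β) * ξ ^ 2))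

lemma pg_hh (β : ℝ) (i : ℕ) (x : ℝ) : pg (β / 2) (qP β i) x = (hh β i x : ℂ) := by
  unfold pg hh; rw [qP_eval]

lemma fourier_hh (β : ℝ) (hβ : 0 < β) (i : ℕ) (hi : i < 12) : 𝓕 (pg (β / 2) (qP β i)) = fun ξ => (hF β i ξ : ℂ) := by
  induction i with
  | zero =>
    have hπ := Real.pi_pos
    have e : pg (β / 2) (qP β 0) = fun x : ℝ => Complex.exp (-Real.pi * ((β / (2 * Real.pi) : ℝ) : ℂ) * x ^ 2) := by
      ext x
      rw [pg_hh]
      have a0 : aP 0 (β * x ^ 2) = 1 := by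
        unfold aP
        rw [Finset.sum_eq_single 0]
        · rw [aT_zero 0 (by norm_num)]; simp
        · intro m hm h; rw [aT_zero m (by have := Finset.mem_range.1 hm; omega)]; simp [h]
        · simp
      unfold hh
      rw [a0]
      push_cast
      rw [one_mul]; congr 1
      field_simp
    rw [e, fourier_gaussian_pi (by rw [Complex.ofReal_re]; positivity)]
    ext ξ
    unfold hF
    have e1 : ((β / (2 * Real.pi) : ℝ) : ℂ) ^ (1 / 2 : ℂ) = ((Real.sqrt (β / (2 * Real.pi)) : ℝ) : ℂ) := by
      rw [Real.sqrt_eq_rpow, Complex.ofReal_cpow (by positivity)]; simp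
    rw [e1]
    have e2 : Real.sqrt (2 * Real.pi / β) = 1 / Real.sqrt (β / (2 * Real.pi)) := by
      rw [one_div, ← Real.sqrt_inv, inv_div]
    rw [e2, pow_zero, one_mul]
    push_cast
    congr 2
    field_simp
  | succ i ih =>
    have ih := ih (by omega)
    have hc : 0 < β / 2 := by positivity
    have h2c : 2 * (β / 2) = β := by ring
    have d : ∀ q : ℝ[X], deriv (pg (β / 2) q) = pg (β / 2) (derivative q - C β * X * q) := by
      intro q; ext x; rw [(pg_deriv (β / 2) q x).deriv, h2c]
    have fd : ∀ q : ℝ[X], 𝓕 (pg (β / 2) (derivative q - C β * X * q)) = fun ξ : ℝ => (2 * Real.pi * Complex.I * ξ) • 𝓕 (pg (β / 2) q) ξ := by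
      intro q
      rw [← d]
      refine Real.fourier_deriv (pg_int _ hc _) (fun x => (pg_deriv _ q x).differentiableAt) ?_
      rw [d]; exact pg_int _ hc _
    have h3 := fd (derivative (qP β i) - C β * X * qP β i)
    rw [fd (qP β i), ih, qP_succ β i (by omega)] at h3
    have h4 : pg (β / 2) (qP β (i + 1)) = fun x => (-(1 / β : ℝ) : ℂ) • pg (β / 2) (-C β * qP β (i + 1)) x := by
      ext x; unfold pg; rw [eval_mul]
      have hb : (β : ℂ) ≠ 0 := by exact_mod_cast hβ.ne'
      simp; field_simp
    have h5 : 𝓕 (pg (β / 2) (qP β (i + 1))) = fun ξ => (-(1 / β : ℝ) : ℂ) • 𝓕 (pg (β / 2) (-C β * qP β (i + 1))) ξ := by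
      ext ξ
      rw [h4]
      simp only [Real.fourier_eq]
      rw [← integral_smul]
      refine integral_congr_ae (Eventually.of_forall fun x => ?_)
      simp only
      rw [smul_comm]
    rw [h5, h3]
    ext ξ
    simp only [smul_eq_mul]
    unfold hF
    push_cast
    rw [pow_succ _ i]
    have hI := Complex.I_sq
    generalize (4 * (Real.pi : ℂ) ^ 2 / β * (ξ : ℂ) ^ 2) ^ i = Q
    generalize Complex.exp (-(2 * (Real.pi : ℂ) ^ 2 / β) * (ξ : ℂ) ^ 2) = E
    linear_combination (-(4 * (Real.pi : ℂ) ^ 2 * (ξ : ℂ) ^ 2 / β) * (Real.sqrt (2 * Real.pi / β) : ℂ) * Q * E) * hI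

lemma hF_O (β : ℝ) (hβ : 0 < β) (i : ℕ) : (fun ξ => (hF β i ξ : ℂ)) =O[cocompact ℝ] fun x : ℝ => |x| ^ (-2 : ℝ) := by
  have := pg_O (2 * Real.pi ^ 2 / β) (by positivity) (C (Real.sqrt (2 * Real.pi / β)) * (C (4 * Real.pi ^ 2 / β) * X ^ 2) ^ i)
  refine this.congr_left fun x => ?_
  unfold pg hF; simp; ring

lemma poisson1 (β : ℝ) (hβ : 0 < β) (i : ℕ) (hi : i < 12) (t : ℝ) :
    (Summable fun n : ℤ => ‖(hh β i (t + n) : ℂ)‖) ∧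
    (Summable fun n : ℤ => ‖(hF β i n : ℂ) * Complex.exp (2 * Real.pi * Complex.I * n * t)‖) ∧
    ∑' n : ℤ, (hh β i (t + n) : ℂ) = ∑' n : ℤ, (hF β i n : ℂ) * Complex.exp (2 * Real.pi * Complex.I * n * t) := by
  have hO := pg_O (β / 2) (by positivity) (qP β i)
  have hc := pg_cont (β / 2) (qP β i)
  have hFO := hF_O β hβ i
  have hF' : 𝓕 (pg (β / 2) (qP β i)) =O[cocompact ℝ] fun x : ℝ => |x| ^ (-2 : ℝ) := by
    rw [fourier_hh β hβ i hi]; exact hFO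
  have e := Real.tsum_eq_tsum_fourier_of_rpow_decay hc one_lt_two hO hF' t
  rw [fourier_hh β hβ i hi] at e
  simp only [pg_hh] at e
  refine ⟨?_, ?_, ?_⟩
  · have h1 := summable_of_isBigO (Real.summable_abs_int_rpow one_lt_two)
      ((isBigO_norm_restrict_cocompact ⟨_, hc⟩ (by norm_num : (0 : ℝ) < 2) hO ⟨{t}, isCompact_singleton⟩).comp_tendsto
        Int.tendsto_coe_cofinite)
    refine Summable.of_nonneg_of_le (fun _ => norm_nonneg _) (fun n => ?_) h1
    have := ContinuousMap.norm_coe_le_norm ((ContinuousMap.comp ⟨_, hc⟩ (ContinuousMap.addRight (n : ℝ))).restrict ({t} : Set ℝ)) ⟨t, rfl⟩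
    simp only [ContinuousMap.restrict_apply, ContinuousMap.comp_apply, ContinuousMap.coe_addRight, ContinuousMap.coe_mk, pg_hh] at this
    exact this
  · have h1 := summable_of_isBigO (Real.summable_abs_int_rpow one_lt_two) (hFO.comp_tendsto Int.tendsto_coe_cofinite)
    refine h1.norm.congr fun n => ?_
    rw [norm_mul]
    have : ‖Complex.exp (2 * Real.pi * Complex.I * n * t)‖ = 1 := by
      have : (2 * Real.pi * Complex.I * n * t : ℂ) = ((2 * Real.pi * n * t : ℝ) : ℂ) * Complex.I := by push_cast; ring
      rw [this, Complex.norm_exp_ofReal_mul_I]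
    rw [this, mul_one]; rfl
  · rw [e]
    refine tsum_congr fun n => ?_
    rw [fourier_coe_apply]; simp
end fourier


/-- the three-dimensional auxiliary function and its transform -/
noncomputable def G3 (β w1 w2 w3 : ℝ) : ℝ :=
  PL CP (β * w1 ^ 2) (β * w2 ^ 2) (β * w3 ^ 2) * Real.exp (-(β / 2) * (w1 ^ 2 + w2 ^ 2 + w3 ^ 2))
noncomputable def F3 (β w1 w2 w3 : ℝ) : ℝ :=
  Real.sqrt (2 * Real.pi / β) ^ 3 * (PL CH (4 * Real.pi ^ 2 / β * w1 ^ 2) (4 * Real.pi ^ 2 / β * w2 ^ 2) (4 * Real.pi ^ 2 / β * w3 ^ 2)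
    * Real.exp (-(2 * Real.pi ^ 2 / β) * (w1 ^ 2 + w2 ^ 2 + w3 ^ 2)))

lemma G3_eq (β w1 w2 w3 : ℝ) : G3 β w1 w2 w3 = ∑ i ∈ Finset.range 12, ∑ j ∈ Finset.range 12, ∑ k ∈ Finset.range 12,
    CH i j k * (hh β i w1 * (hh β j w2 * hh β k w3)) := by
  unfold G3 hh
  rw [PL_link, mul_add, mul_add, Real.exp_add, Real.exp_add]
  simp only [Finset.sum_mul]
  refine Finset.sum_congr rfl fun i _ => Finset.sum_congr rfl fun j _ => Finset.sum_congr rfl fun k _ => ?_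
  ring

lemma F3_eq (β w1 w2 w3 : ℝ) : F3 β w1 w2 w3 = ∑ i ∈ Finset.range 12, ∑ j ∈ Finset.range 12, ∑ k ∈ Finset.range 12,
    CH i j k * (hF β i w1 * (hF β j w2 * hF β k w3)) := by
  unfold F3 hF PL
  rw [mul_add (-(2 * Real.pi ^ 2 / β)), mul_add (-(2 * Real.pi ^ 2 / β)), Real.exp_add, Real.exp_add]
  simp only [Finset.sum_mul, Finset.mul_sum]
  refine Finset.sum_congr rfl fun i _ => Finset.sum_congr rfl fun j _ => Finset.sum_congr rfl fun k _ => ?_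
  ring

lemma hasSum2 {α γ : Type} (f : α → ℂ) (g : γ → ℂ) (a b : ℂ) (hf : Summable fun n => ‖f n‖) (hg : Summable fun n => ‖g n‖)
    (ha : HasSum f a) (hb : HasSum g b) :
    HasSum (fun n : α × γ => f n.1 * g n.2) (a * b) ∧ Summable fun n : α × γ => ‖f n.1 * g n.2‖ :=
  ⟨ha.mul hb (summable_mul_of_summable_norm hf hg), hf.mul_norm hg⟩

lemma hasSum3 (f g h : ℤ → ℂ) (a b c : ℂ) (hf : Summable fun n => ‖f n‖) (hg : Summable fun n => ‖g n‖)
    (hh : Summable fun n => ‖h n‖) (ha : ∑' n, f n = a) (hb : ∑' n, g n = b) (hc : ∑' n, h n = c) :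
    HasSum (fun n : ℤ × ℤ × ℤ => f n.1 * (g n.2.1 * h n.2.2)) (a * (b * c)) := by
  subst ha hb hc
  obtain ⟨h3, h4⟩ := hasSum2 g h _ _ hg hh hg.of_norm.hasSum hh.of_norm.hasSum
  exact (hasSum2 f (fun n : ℤ × ℤ => g n.1 * h n.2) _ _ hf h4 hf.of_norm.hasSum h3).1

lemma hasSum333 (f g h : ℕ → ℤ → ℂ) (A B D : ℕ → ℂ) (W : ℕ → ℕ → ℕ → ℂ)
    (hf : ∀ i < 12, (Summable fun n => ‖f i n‖) ∧ ∑' n, f i n = A i)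
    (hg : ∀ i < 12, (Summable fun n => ‖g i n‖) ∧ ∑' n, g i n = B i)
    (hh : ∀ i < 12, (Summable fun n => ‖h i n‖) ∧ ∑' n, h i n = D i) :
    HasSum (fun n : ℤ × ℤ × ℤ => ∑ i ∈ Finset.range 12, ∑ j ∈ Finset.range 12, ∑ k ∈ Finset.range 12,
      W i j k * (f i n.1 * (g j n.2.1 * h k n.2.2)))
      (∑ i ∈ Finset.range 12, ∑ j ∈ Finset.range 12, ∑ k ∈ Finset.range 12, W i j k * (A i * (B j * D k))) := by
  refine hasSum_sum fun i hi => hasSum_sum fun j hj => hasSum_sum fun k hk => HasSum.mul_left (W i j k) ?_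
  have hi := hf i (Finset.mem_range.1 hi)
  have hj := hg j (Finset.mem_range.1 hj)
  have hk := hh k (Finset.mem_range.1 hk)
  exact hasSum3 (f i) (g j) (h k) _ _ _ hi.1 hj.1 hk.1 hi.2 hj.2 hk.2

lemma poisson3 (β : ℝ) (hβ : 0 < β) (t1 t2 t3 : ℝ) : ∃ R : ℝ,
    HasSum (fun n : ℤ × ℤ × ℤ => G3 β (t1 + n.1) (t2 + n.2.1) (t3 + n.2.2)) R ∧
    HasSum (fun n : ℤ × ℤ × ℤ => F3 β n.1 n.2.1 n.2.2 * Real.cos (2 * Real.pi * (n.1 * t1 + n.2.1 * t2 + n.2.2 * t3))) R := by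
  have pp := fun t i hi => poisson1 β hβ i hi t
  have g := hasSum333 (fun i n => (hh β i (t1 + n) : ℂ)) (fun i n => (hh β i (t2 + n) : ℂ)) (fun i n => (hh β i (t3 + n) : ℂ))
    _ _ _ (fun i j k => (CH i j k : ℂ)) (fun i hi => ⟨(pp t1 i hi).1, rfl⟩) (fun i hi => ⟨(pp t2 i hi).1, rfl⟩)
    (fun i hi => ⟨(pp t3 i hi).1, rfl⟩)
  have f := hasSum333 (fun i n => (hF β i n : ℂ) * Complex.exp (2 * Real.pi * Complex.I * n * t1))
    (fun i n => (hF β i n : ℂ) * Complex.exp (2 * Real.pi * Complex.I * n * t2))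
    (fun i n => (hF β i n : ℂ) * Complex.exp (2 * Real.pi * Complex.I * n * t3))
    _ _ _ (fun i j k => (CH i j k : ℂ)) (fun i hi => ⟨(pp t1 i hi).2.1, (pp t1 i hi).2.2.symm⟩)
    (fun i hi => ⟨(pp t2 i hi).2.1, (pp t2 i hi).2.2.symm⟩)
    (fun i hi => ⟨(pp t3 i hi).2.1, (pp t3 i hi).2.2.symm⟩)
  refine ⟨_, (Complex.hasSum_re g).congr_fun ?_, (Complex.hasSum_re f).congr_fun ?_⟩
  · intro n
    rw [G3_eq, ← Complex.ofReal_re (∑ i ∈ Finset.range 12, _)]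
    congr 1
    push_cast
    rfl
  · intro n
    have e : (∑ i ∈ Finset.range 12, ∑ j ∈ Finset.range 12, ∑ k ∈ Finset.range 12,
      (CH i j k : ℂ) * ((hF β i n.1 * Complex.exp (2 * Real.pi * Complex.I * n.1 * t1)) *
        ((hF β j n.2.1 * Complex.exp (2 * Real.pi * Complex.I * n.2.1 * t2)) *
        (hF β k n.2.2 * Complex.exp (2 * Real.pi * Complex.I * n.2.2 * t3))))) =
        (F3 β n.1 n.2.1 n.2.2 : ℂ) * Complex.exp ((2 * Real.pi * (n.1 * t1 + n.2.1 * t2 + n.2.2 * t3) : ℝ) * Complex.I) := by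
      have e2 : Complex.exp ((2 * Real.pi * (n.1 * t1 + n.2.1 * t2 + n.2.2 * t3) : ℝ) * Complex.I) =
        Complex.exp (2 * Real.pi * Complex.I * n.1 * t1) * (Complex.exp (2 * Real.pi * Complex.I * n.2.1 * t2) *
          Complex.exp (2 * Real.pi * Complex.I * n.2.2 * t3)) := by
        rw [← Complex.exp_add, ← Complex.exp_add]; congr 1; push_cast; ring
      rw [e2, F3_eq]
      push_cast
      simp only [Finset.sum_mul]
      refine Finset.sum_congr rfl fun i _ => Finset.sum_congr rfl fun j _ => Finset.sum_congr rfl fun k _ => ?_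
      ring
    rw [e, Complex.re_ofReal_mul, Complex.exp_ofReal_mul_I_re]

lemma G3_nonpos (β w1 w2 w3 : ℝ) (hβ : 0 < β) (h : 400 ≤ 9 * β ^ 2 * (w1 ^ 4 + w2 ^ 4 + w3 ^ 4)) : G3 β w1 w2 w3 ≤ 0 := by
  unfold G3
  refine mul_nonpos_of_nonpos_of_nonneg (H1 _ _ _ (by positivity) (by positivity) (by positivity) ?_) (Real.exp_pos _).le
  nlinarith

lemma F3_nonneg (β w1 w2 w3 : ℝ) (hβ : 0 < β) : 0 ≤ F3 β w1 w2 w3 := by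
  unfold F3
  refine mul_nonneg (by positivity) (mul_nonneg (H2 _ _ _ (by positivity) (by positivity) (by positivity)) (Real.exp_pos _).le)

lemma cos_pairs {ι : Type*} (S : Finset ι) (θ : ι → ℝ) : 0 ≤ ∑ x ∈ S, ∑ y ∈ S, Real.cos (θ x - θ y) := by
  have : ∑ x ∈ S, ∑ y ∈ S, Real.cos (θ x - θ y) = (∑ x ∈ S, Real.cos (θ x)) ^ 2 + (∑ x ∈ S, Real.sin (θ x)) ^ 2 := by
    simp only [Real.cos_sub, Finset.sum_add_distrib, sq, Finset.sum_mul_sum]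
  rw [this]; positivity

/-- the linear programming bound for finite sets in a cube -/
lemma lp {ι : Type*} [DecidableEq ι] (S : Finset ι) (p1 p2 p3 : ι → ℝ) (s : ℝ) (hs : 0 < s)
    (h1 : ∀ x ∈ S, ∀ y ∈ S, |p1 x - p1 y| ≤ s) (h2 : ∀ x ∈ S, ∀ y ∈ S, |p2 x - p2 y| ≤ s)
    (h3 : ∀ x ∈ S, ∀ y ∈ S, |p3 x - p3 y| ≤ s)
    (hp : ∀ x ∈ S, ∀ y ∈ S, x ≠ y → 16 ≤ (p1 x - p1 y) ^ 4 + (p2 x - p2 y) ^ 4 + (p3 x - p3 y) ^ 4) :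
    (S.card : ℝ) * (Real.sqrt (2 * Real.pi / (5 / 3)) ^ 3 * CH 0 0 0) ≤ (s + 2) ^ 3 * CP 0 0 0 := by
  set l := s + 2 with hl
  have hl0 : 0 < l := by positivity
  set β := 5 / 3 * l ^ 2 with hβd
  have hβ : 0 < β := by positivity
  choose R hR1 hR2 using poisson3 β hβ
  have PL0 : ∀ D, PL D 0 0 0 = D 0 0 0 := by
    intro D; unfold PL
    simp [Finset.sum_range_succ]
  have G0 : G3 β 0 0 0 = CP 0 0 0 := by unfold G3; simp [PL0]
  have F0 : F3 β 0 0 0 = Real.sqrt (2 * Real.pi / (5 / 3)) ^ 3 * CH 0 0 0 / l ^ 3 := by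
    unfold F3
    have : Real.sqrt (2 * Real.pi / β) = Real.sqrt (2 * Real.pi / (5 / 3)) / l := by
      rw [hβd, ← div_div, Real.sqrt_div' _ (by positivity), Real.sqrt_sq hl0.le]
    rw [this]; simp [PL0]; field_simp
  have key : ∀ a b c : ℝ, ∀ n : ℤ × ℤ × ℤ, 16 ≤ (a + l * n.1) ^ 4 + (b + l * n.2.1) ^ 4 + (c + l * n.2.2) ^ 4 →
      G3 β (a / l + n.1) (b / l + n.2.1) (c / l + n.2.2) ≤ 0 := by
    intro a b c n h
    refine G3_nonpos _ _ _ _ hβ ?_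
    have e : 9 * β ^ 2 * ((a / l + n.1) ^ 4 + (b / l + n.2.1) ^ 4 + (c / l + n.2.2) ^ 4) =
      25 * ((a + l * n.1) ^ 4 + (b + l * n.2.1) ^ 4 + (c + l * n.2.2) ^ 4) := by
      rw [hβd]; field_simp; ring
    rw [e]; linarith
  have big : ∀ a : ℝ, |a| ≤ s → ∀ n : ℤ, n ≠ 0 → 16 ≤ (a + l * n) ^ 4 := by
    intro a ha n hn
    have h1 : (1 : ℝ) ≤ |(n : ℝ)| := by exact_mod_cast Int.one_le_abs hn
    have h2 : l ≤ |l * n| := by rw [abs_mul, abs_of_pos hl0]; nlinarith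
    have h3 : |l * n| ≤ |a + l * n| + |a| := by
      have := abs_sub (a + l * n) a; simpa using this
    have h4 : 2 ≤ |a + l * n| := by linarith
    have h5 : (2 : ℝ) ^ 4 ≤ |a + l * n| ^ 4 := pow_le_pow_left₀ (by norm_num) h4 4
    have h6 : |a + l * n| ^ 4 = (a + l * n) ^ 4 := by rw [Even.pow_abs (by decide)]
    rw [h6] at h5; linarith
  have all : ∀ a b c : ℝ, |a| ≤ s → |b| ≤ s → |c| ≤ s → ∀ n : ℤ × ℤ × ℤ, n ≠ 0 →
      G3 β (a / l + n.1) (b / l + n.2.1) (c / l + n.2.2) ≤ 0 := by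
    intro a b c ha hb hc n hn
    apply key
    have p1 : 0 ≤ (a + l * n.1) ^ 4 := Even.pow_nonneg (by decide) _
    have p2 : 0 ≤ (b + l * n.2.1) ^ 4 := Even.pow_nonneg (by decide) _
    have p3 : 0 ≤ (c + l * n.2.2) ^ 4 := Even.pow_nonneg (by decide) _
    by_cases q1 : n.1 = 0
    · by_cases q2 : n.2.1 = 0
      · by_cases q3 : n.2.2 = 0
        · exact absurd (Prod.ext q1 (Prod.ext q2 q3)) hn
        · have := big c hc _ q3; linarith
      · have := big b hb _ q2; linarith
    · have := big a ha _ q1; linarith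
  set RR : ι → ι → ℝ := fun x y => R ((p1 x - p1 y) / l) ((p2 x - p2 y) / l) ((p3 x - p3 y) / l) with hRR
  have up : ∑ x ∈ S, ∑ y ∈ S, RR x y ≤ S.card * CP 0 0 0 := by
    have : ∀ x ∈ S, ∑ y ∈ S, RR x y ≤ CP 0 0 0 := by
      intro x hx
      calc ∑ y ∈ S, RR x y ≤ ∑ y ∈ S, if x = y then CP 0 0 0 else 0 := by
            refine Finset.sum_le_sum fun y hy => ?_
            have hR := hR1 ((p1 x - p1 y) / l) ((p2 x - p2 y) / l) ((p3 x - p3 y) / l)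
            have hall := all _ _ _ (h1 x hx y hy) (h2 x hx y hy) (h3 x hx y hy)
            split_ifs with hxy
            · subst hxy
              have := le_hasSum hR.neg 0 (fun j hj => by have := hall j hj; linarith)
              simp [G0] at this
              simpa [hRR] using this
            · refine hasSum_le (fun n => ?_) hR hasSum_zero
              by_cases hn : n = 0
              · apply key
                have := hp x hx y hy hxy
                simpa [hn] using this
              · exact hall n hn
        _ = CP 0 0 0 := by simp [hx]
    calc _ ≤ ∑ x ∈ S, CP 0 0 0 := Finset.sum_le_sum this
      _ = _ := by simp
  have lo : (S.card : ℝ) ^ 2 * F3 β 0 0 0 ≤ ∑ x ∈ S, ∑ y ∈ S, RR x y := by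
    have hS : HasSum (fun n : ℤ × ℤ × ℤ => ∑ x ∈ S, ∑ y ∈ S, F3 β n.1 n.2.1 n.2.2 *
        Real.cos (2 * Real.pi * (n.1 * ((p1 x - p1 y) / l) + n.2.1 * ((p2 x - p2 y) / l) + n.2.2 * ((p3 x - p3 y) / l))))
        (∑ x ∈ S, ∑ y ∈ S, RR x y) := hasSum_sum fun x _ => hasSum_sum fun y _ => hR2 _ _ _
    have := le_hasSum hS 0 (fun n _ => by
      simp only [← Finset.mul_sum]
      refine mul_nonneg (F3_nonneg _ _ _ _ hβ) ?_
      have := cos_pairs S (fun x => 2 * Real.pi * (n.1 * (p1 x / l) + n.2.1 * (p2 x / l) + n.2.2 * (p3 x / l)))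
      refine this.trans_eq ?_
      refine Finset.sum_congr rfl fun x _ => Finset.sum_congr rfl fun y _ => ?_
      congr 1; ring)
    refine le_trans (le_of_eq ?_) this
    simp; ring
  rcases Nat.eq_zero_or_pos S.card with h0 | h0
  · have hN := up.trans' lo
    have := H1
    rw [h0]
    have hc : 0 ≤ CP 0 0 0 := by
      have hS : HasSum (fun n : ℤ × ℤ × ℤ => F3 β n.1 n.2.1 n.2.2 * Real.cos (2 * Real.pi * (n.1 * 0 + n.2.1 * 0 + n.2.2 * 0))) (R 0 0 0) := hR2 0 0 0
      have a1 : 0 ≤ R 0 0 0 := hS.nonneg (fun n => by simpa using F3_nonneg _ _ _ _ hβ)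
      have a2 := le_hasSum (hR1 0 0 0).neg 0 (fun j hj => by
        have := all 0 0 0 (by simpa using hs.le) (by simpa using hs.le) (by simpa using hs.le) j hj
        simp only [zero_div] at this; linarith)
      simp [G0] at a2
      linarith
    simp; positivity
  · have hN : (0 : ℝ) < S.card := by exact_mod_cast h0
    have := lo.trans up
    rw [sq, mul_assoc] at this
    have := le_of_mul_le_mul_left this hN
    rw [F0] at this
    rw [← mul_div_assoc, div_le_iff₀ (by positivity)] at this
    linarith


section gamma
open Real

lemma gam_step (n : ℕ) (hn : 0 < n) :
    (Gamma ((n + 1 : ℕ) + 3 / 4) / Gamma ((n + 1 : ℕ) + 1 / 4)) ^ 2 / (n + 1 : ℕ) ≤ (Gamma (n + 3 / 4) / Gamma (n + 1 / 4)) ^ 2 / n := by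
  have hn' : (0 : ℝ) < n := by exact_mod_cast hn
  have e1 : Gamma ((n + 1 : ℕ) + 3 / 4) = (n + 3 / 4) * Gamma (n + 3 / 4) := by
    rw [← Gamma_add_one (by positivity)]; congr 1; push_cast; ring
  have e2 : Gamma ((n + 1 : ℕ) + 1 / 4) = (n + 1 / 4) * Gamma (n + 1 / 4) := by
    rw [← Gamma_add_one (by positivity)]; congr 1; push_cast; ring
  have p2 : 0 < Gamma (n + 1 / 4 : ℝ) := Gamma_pos_of_pos (by positivity)
  rw [e1, e2, mul_div_mul_comm, mul_pow]
  set g := (Gamma (n + 3 / 4 : ℝ) / Gamma (n + 1 / 4)) ^ 2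
  have hg : 0 ≤ g := sq_nonneg _
  have h : ((n + 3 / 4) / (n + 1 / 4) : ℝ) ^ 2 * n ≤ n + 1 := by
    rw [div_pow, div_mul_eq_mul_div, div_le_iff₀ (by positivity)]
    nlinarith
  push_cast
  rw [div_le_div_iff₀ (by positivity) hn']
  calc _ = (((n + 3 / 4) / (n + 1 / 4) : ℝ) ^ 2 * n) * g := by ring
    _ ≤ _ := by nlinarith

lemma gam_low (n : ℕ) (hn : 0 < n) : 1 - 1 / (4 * n) ≤ (Gamma (n + 3 / 4) / Gamma (n + 1 / 4)) ^ 2 / (n : ℝ) := by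
  have hn1 : (1 : ℝ) ≤ n := by exact_mod_cast hn
  have hn' : (0 : ℝ) < n := by linarith
  have p1 : 0 < Gamma (n - 1 / 4 : ℝ) := Gamma_pos_of_pos (by linarith)
  have p2 : 0 < Gamma (n + 1 / 4 : ℝ) := Gamma_pos_of_pos (by positivity)
  have p3 : 0 < Gamma (n + 3 / 4 : ℝ) := Gamma_pos_of_pos (by positivity)
  have h := Gamma_mul_add_mul_le_rpow_Gamma_mul_rpow_Gamma (s := n - 1 / 4) (t := n + 3 / 4) (a := 1 / 2) (b := 1 / 2)
    (by linarith) (by positivity) (by norm_num) (by norm_num) (by norm_num)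
  rw [show (1 / 2 * (n - 1 / 4) + 1 / 2 * (n + 3 / 4) : ℝ) = n + 1 / 4 by ring, ← mul_rpow p1.le p3.le, ← sqrt_eq_rpow] at h
  have h2 : Gamma (n + 1 / 4 : ℝ) ^ 2 ≤ Gamma (n - 1 / 4 : ℝ) * Gamma (n + 3 / 4) := by
    rw [← Real.sq_sqrt (by positivity : 0 ≤ Gamma (n - 1 / 4 : ℝ) * Gamma (n + 3 / 4))]
    gcongr
  have e : Gamma (n + 3 / 4 : ℝ) = (n - 1 / 4) * Gamma (n - 1 / 4 : ℝ) := by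
    rw [← Gamma_add_one (by linarith)]; congr 1; ring
  have e' : (1 - 1 / (4 * n) : ℝ) = (n - 1 / 4) / n := by field_simp
  rw [e', div_le_div_iff_of_pos_right hn', div_pow, le_div_iff₀ (by positivity)]
  calc _ ≤ (n - 1 / 4) * (Gamma (n - 1 / 4 : ℝ) * Gamma (n + 3 / 4)) := by
        apply mul_le_mul_of_nonneg_left h2; linarith
    _ = _ := by rw [sq]; nth_rewrite 2 [e]; ring

lemma gam_one (n : ℕ) (hn : 0 < n) : (n : ℝ) ≤ (Gamma (n + 3 / 4) / Gamma (n + 1 / 4)) ^ 2 := by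
  have hn' : (0 : ℝ) < n := by exact_mod_cast hn
  have mono : ∀ m : ℕ, (Gamma ((n + m : ℕ) + 3 / 4) / Gamma ((n + m : ℕ) + 1 / 4)) ^ 2 / ((n + m : ℕ) : ℝ) ≤ (Gamma (n + 3 / 4) / Gamma (n + 1 / 4)) ^ 2 / n := by
    intro m
    induction m with
    | zero => simp
    | succ m ih => exact (gam_step (n + m) (by omega)).trans ih
  have h : ∀ m : ℕ, 1 - 1 / (4 * (n + m : ℕ)) ≤ (Gamma (n + 3 / 4) / Gamma (n + 1 / 4)) ^ 2 / (n : ℝ) := fun m =>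
    (gam_low (n + m) (by omega)).trans (mono m)
  have h1 : 1 ≤ (Gamma (n + 3 / 4) / Gamma (n + 1 / 4)) ^ 2 / (n : ℝ) := by
    by_contra hc
    push Not at hc
    obtain ⟨m, hm⟩ := exists_nat_gt (1 / (1 - (Gamma (n + 3 / 4) / Gamma (n + 1 / 4)) ^ 2 / (n : ℝ)))
    have := h m
    set q := (Gamma (n + 3 / 4) / Gamma (n + 1 / 4)) ^ 2 / (n : ℝ)
    have hq : 0 < 1 - q := by linarith
    rw [div_lt_iff₀ hq] at hm
    have hnm : (0 : ℝ) < (n + m : ℕ) := by exact_mod_cast (by omega)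
    have h3 : 1 - q ≤ 1 / (4 * (n + m : ℕ)) := by linarith
    rw [le_div_iff₀ (by positivity)] at h3
    push_cast at h3
    nlinarith
  rwa [le_div_iff₀ hn', one_mul] at h1

lemma gam_prod (n : ℕ) : Gamma (3 / 4 : ℝ) * (∏ k ∈ Finset.range n, ((k + 3 / 4) / (k + 1 / 4) : ℝ)) * Gamma (n + 1 / 4) = Gamma (1 / 4) * Gamma (n + 3 / 4) := by
  induction n with
  | zero => simp; ring
  | succ n ih =>
    have e1 : Gamma ((n + 1 : ℕ) + 3 / 4) = (n + 3 / 4) * Gamma (n + 3 / 4) := by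
      rw [← Gamma_add_one (by positivity)]; congr 1; push_cast; ring
    have e2 : Gamma ((n + 1 : ℕ) + 1 / 4) = (n + 1 / 4) * Gamma (n + 1 / 4) := by
      rw [← Gamma_add_one (by positivity)]; congr 1; push_cast; ring
    rw [e1, e2, Finset.prod_range_succ]
    have h0 : (n + 1 / 4 : ℝ) ≠ 0 := by positivity
    have h1 : ((n + 3 / 4) / (n + 1 / 4) : ℝ) * (n + 1 / 4) = n + 3 / 4 := div_mul_cancel₀ _ h0
    generalize (∏ k ∈ Finset.range n, ((k + 3 / 4) / (k + 1 / 4) : ℝ)) = Q at ih ⊢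
    generalize ((n + 3 / 4) / (n + 1 / 4) : ℝ) = q at h1 ⊢
    linear_combination (n + 3 / 4 : ℝ) * ih + Gamma (3 / 4) * Q * Gamma (n + 1 / 4) * h1

lemma gam_refl : Gamma (1 / 4 : ℝ) * Gamma (3 / 4) = π * √2 := by
  have := Gamma_mul_Gamma_one_sub (1 / 4)
  rw [show (1 - 1 / 4 : ℝ) = 3 / 4 by norm_num, show π * (1 / 4) = π / 4 by ring, sin_pi_div_four] at this
  rw [this]
  have := Real.sq_sqrt (show (0 : ℝ) ≤ 2 by norm_num)
  field_simp
  linarith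

/-- volume of the body, as a number -/
noncomputable def VB : ℝ := (2 * Gamma (1 / 4 + 1)) ^ 3 / Gamma (3 / 4 + 1)
noncomputable def KK : ℝ := CP 0 0 0 / (√(2 * π / (5 / 3)) ^ 3 * CH 0 0 0)

lemma CP0 : CP 0 0 0 = 18210381831126823750 := by
  have : cf tPp tPn 0 0 0 = 18210381831126823750 := by decide +kernel
  unfold CP; rw [this]; norm_num
lemma CH0 : CH 0 0 0 = 18446744073709551613 := by
  have : cf tHp tHn 0 0 0 = -18446744073709551613 := by decide +kernel
  unfold CH; rw [this]; norm_num

lemma VB_pos : 0 < VB := by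
  unfold VB
  have := Gamma_pos_of_pos (show (0 : ℝ) < 1 / 4 + 1 by norm_num)
  have := Gamma_pos_of_pos (show (0 : ℝ) < 3 / 4 + 1 by norm_num)
  positivity

lemma KK_pos : 0 < KK := by
  unfold KK; rw [CP0, CH0]; have := pi_pos; positivity

lemma VB_le : VB ≤ π * (∏ k ∈ Finset.range 40, ((k + 3 / 4) / (k + 1 / 4) : ℝ)) ^ 2 / (3 * √2 * 40) := by
  set P := ∏ k ∈ Finset.range 40, ((k + 3 / 4) / (k + 1 / 4) : ℝ) with hP
  have h1 := gam_one 40 (by norm_num)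
  have h2 := gam_prod 40
  rw [← hP] at h2
  have p1 := Gamma_pos_of_pos (show (0 : ℝ) < 1 / 4 by norm_num)
  have p3 := Gamma_pos_of_pos (show (0 : ℝ) < 3 / 4 by norm_num)
  have q1 := Gamma_pos_of_pos (show (0 : ℝ) < (40 : ℕ) + 1 / 4 by norm_num)
  have q3 := Gamma_pos_of_pos (show (0 : ℝ) < (40 : ℕ) + 3 / 4 by norm_num)
  have r := gam_refl
  have e : Gamma ((40 : ℕ) + 3 / 4 : ℝ) / Gamma ((40 : ℕ) + 1 / 4) = Gamma (3 / 4) * P / Gamma (1 / 4) := by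
    rw [div_eq_div_iff q1.ne' p1.ne']; linarith
  rw [e] at h1
  unfold VB
  rw [Gamma_add_one (by norm_num), Gamma_add_one (by norm_num)]
  set a := Gamma (1 / 4 : ℝ)
  set b := Gamma (3 / 4 : ℝ)
  have hs := Real.sq_sqrt (show (0 : ℝ) ≤ 2 by norm_num)
  have hs0 : 0 < √2 := by positivity
  rw [div_pow, le_div_iff₀ (by positivity)] at h1
  push_cast at h1
  have hb : π = a * b * √2 / 2 := by rw [r, mul_assoc, ← sq, hs]; ring
  rw [hb, div_le_div_iff₀ (by positivity) (by positivity)]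
  have : 0 < a * √2 := by positivity
  have h3 := mul_le_mul_of_nonneg_left h1 this.le
  calc (2 * (1 / 4 * a)) ^ 3 * (3 * √2 * 40) = 3 / 8 * (a * √2 * (40 * a ^ 2)) := by ring
    _ ≤ 3 / 8 * (a * √2 * (b * P) ^ 2) := mul_le_mul_of_nonneg_left h3 (by norm_num)
    _ = _ := by ring

lemma num : VB * KK < 0.8743 := by
  have hπ := pi_gt_d6
  have hs := Real.sq_sqrt (show (0 : ℝ) ≤ 2 by norm_num)
  have hs0 : 0 < √2 := by positivity
  have hK := KK_pos
  have hP : (∏ k ∈ Finset.range 40, ((k + 3 / 4) / (k + 1 / 4) : ℝ)) ^ 2 ≤ 350.16 := by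
    simp only [Finset.prod_range_succ, Finset.prod_range_zero]
    norm_num
  have hv := VB_le
  set Q := (∏ k ∈ Finset.range 40, ((k + 3 / 4) / (k + 1 / 4) : ℝ)) ^ 2
  have hQ : 0 ≤ Q := sq_nonneg _
  have hV : VB ^ 2 ≤ π ^ 2 * 350.16 ^ 2 / 28800 := by
    have h1 : VB ^ 2 ≤ (π * Q / (3 * √2 * 40)) ^ 2 := pow_le_pow_left₀ VB_pos.le hv 2
    have h2 : (π * Q / (3 * √2 * 40)) ^ 2 = π ^ 2 * Q ^ 2 / 28800 := by
      rw [div_pow, mul_pow, mul_pow, mul_pow, hs]; norm_num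
    rw [h2] at h1
    refine h1.trans ?_
    gcongr
  have hK2 : KK ^ 2 = 18210381831126823750 ^ 2 / (π ^ 3 * (6 / 5) ^ 3 * 18446744073709551613 ^ 2) := by
    unfold KK
    rw [CP0, CH0, div_pow, mul_pow, ← pow_mul, mul_comm 3 2, pow_mul, Real.sq_sqrt (by positivity)]
    congr 2
    ring
  refine lt_of_pow_lt_pow_left₀ 2 (by norm_num) ?_
  rw [mul_pow, hK2]
  refine (mul_le_mul_of_nonneg_right hV (by positivity)).trans_lt ?_
  have hp : 0 < π := pi_pos
  have : π ^ 2 * 350.16 ^ 2 / 28800 * (18210381831126823750 ^ 2 / (π ^ 3 * (6 / 5) ^ 3 * 18446744073709551613 ^ 2))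
    = (350.16 ^ 2 * 18210381831126823750 ^ 2 / (28800 * (6 / 5) ^ 3 * 18446744073709551613 ^ 2)) / π := by
    field_simp
  rw [this, div_lt_iff₀ hp]
  refine lt_trans ?_ (mul_lt_mul_of_pos_left hπ (by norm_num))
  norm_num
end gamma


lemma lpK {ι : Type*} [DecidableEq ι] (S : Finset ι) (p1 p2 p3 : ι → ℝ) (s : ℝ) (hs : 0 < s)
    (h1 : ∀ x ∈ S, ∀ y ∈ S, |p1 x - p1 y| ≤ s) (h2 : ∀ x ∈ S, ∀ y ∈ S, |p2 x - p2 y| ≤ s)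
    (h3 : ∀ x ∈ S, ∀ y ∈ S, |p3 x - p3 y| ≤ s)
    (hp : ∀ x ∈ S, ∀ y ∈ S, x ≠ y → 16 ≤ (p1 x - p1 y) ^ 4 + (p2 x - p2 y) ^ 4 + (p3 x - p3 y) ^ 4) :
    (S.card : ℝ) ≤ (s + 2) ^ 3 * KK := by
  have := lp S p1 p2 p3 s hs h1 h2 h3 hp
  have hc : 0 < Real.sqrt (2 * Real.pi / (5 / 3)) ^ 3 * CH 0 0 0 := by
    rw [CH0]; have := Real.pi_pos; positivity
  unfold KK
  rw [← mul_div_assoc, le_div_iff₀ hc]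
  exact this

/-- the cube around a point -/
def QQ (s : ℝ) (x : EuclideanSpace ℝ (Fin 3)) : Set (EuclideanSpace ℝ (Fin 3)) :=
  (@WithLp.ofLp 2 (Fin 3 → ℝ)) ⁻¹' closedBall (WithLp.ofLp x) (s / 2)

lemma QQ_vol (s : ℝ) (hs : 0 < s) (x : EuclideanSpace ℝ (Fin 3)) : volume (QQ s x) = ENNReal.ofReal (s ^ 3) := by
  unfold QQ
  rw [(PiLp.volume_preserving_ofLp (Fin 3)).measure_preimage measurableSet_closedBall.nullMeasurableSet,
    Real.volume_pi_closedBall _ (by positivity)]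
  congr 1; simp; ring

lemma QQ_meas (s : ℝ) (x : EuclideanSpace ℝ (Fin 3)) : MeasurableSet (QQ s x) :=
  (PiLp.volume_preserving_ofLp (Fin 3)).measurable measurableSet_closedBall

lemma QQ_mem (s : ℝ) (hs : 0 < s) (x u : EuclideanSpace ℝ (Fin 3)) (h : u ∈ QQ s x) (i : Fin 3) : |u i - x i| ≤ s / 2 := by
  unfold QQ at h
  rw [Set.mem_preimage, mem_closedBall, dist_pi_le_iff (by positivity)] at h
  simpa [Real.dist_eq] using h i

lemma norm_le_of (z : EuclideanSpace ℝ (Fin 3)) (a : ℝ) (ha : 0 ≤ a) (h : ∀ i, |z i| ≤ a) : ‖z‖ ≤ 2 * a := by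
  rw [EuclideanSpace.norm_eq]
  apply Real.sqrt_le_iff.2 ⟨by positivity, ?_⟩
  simp only [Fin.sum_univ_three, Real.norm_eq_abs]
  have h0 := pow_le_pow_left₀ (abs_nonneg _) (h 0) 2
  have h1 := pow_le_pow_left₀ (abs_nonneg _) (h 1) 2
  have h2 := pow_le_pow_left₀ (abs_nonneg _) (h 2) 2
  nlinarith [sq_nonneg a]

/-- counting points by averaging over cubes -/
lemma count (X : Set (EuclideanSpace ℝ (Fin 3)))
    (hX : ∀ x ∈ X, ∀ y ∈ X, x ≠ y → 16 ≤ (x 0 - y 0) ^ 4 + (x 1 - y 1) ^ 4 + (x 2 - y 2) ^ 4)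
    (S : Finset (EuclideanSpace ℝ (Fin 3))) (hS : ∀ x ∈ S, x ∈ X) (c : EuclideanSpace ℝ (Fin 3)) (R s : ℝ) (hs : 0 < s)
    (hR : ∀ x ∈ S, x ∈ closedBall c R) :
    (S.card : ENNReal) * ENNReal.ofReal (s ^ 3) ≤ ENNReal.ofReal ((s + 2) ^ 3 * KK) * volume (closedBall c (R + 2 * s)) := by
  classical
  have e1 : (S.card : ENNReal) * ENNReal.ofReal (s ^ 3) = ∫⁻ u, ∑ x ∈ S, (QQ s x).indicator 1 u := by
    rw [lintegral_finsetSum _ (fun x _ => measurable_one.indicator (QQ_meas s x))]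
    simp only [lintegral_indicator_one (QQ_meas s _), QQ_vol s hs]
    simp
  have e2 : ENNReal.ofReal ((s + 2) ^ 3 * KK) * volume (closedBall c (R + 2 * s)) =
      ∫⁻ u, (closedBall c (R + 2 * s)).indicator (fun _ => ENNReal.ofReal ((s + 2) ^ 3 * KK)) u := by
    rw [lintegral_indicator_const measurableSet_closedBall]
  rw [e1, e2]
  refine lintegral_mono fun u => ?_
  have hsum : ∑ x ∈ S, (QQ s x).indicator (1 : EuclideanSpace ℝ (Fin 3) → ENNReal) u = ((S.filter fun x => u ∈ QQ s x).card : ENNReal) := by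
    simp [Set.indicator_apply, Finset.sum_boole]
  simp only
  rw [hsum]
  by_cases hu : u ∈ closedBall c (R + 2 * s)
  · rw [Set.indicator_of_mem hu, ← ENNReal.ofReal_natCast]
    apply ENNReal.ofReal_le_ofReal
    have hd : ∀ i : Fin 3, ∀ x ∈ S.filter (fun x => u ∈ QQ s x), ∀ y ∈ S.filter (fun x => u ∈ QQ s x), |x i - y i| ≤ s := by
      intro i x hx y hy
      have h1 := QQ_mem s hs x u (Finset.mem_filter.1 hx).2 i
      have h2 := QQ_mem s hs y u (Finset.mem_filter.1 hy).2 i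
      rw [abs_le] at *
      constructor <;> linarith [h1.1, h1.2, h2.1, h2.2]
    refine lpK _ (fun x => x 0) (fun x => x 1) (fun x => x 2) s hs (hd 0) (hd 1) (hd 2) ?_
    intro x hx y hy hxy
    exact hX x (hS x (Finset.mem_filter.1 hx).1) y (hS y (Finset.mem_filter.1 hy).1) hxy
  · have : (S.filter fun x => u ∈ QQ s x) = ∅ := by
      refine Finset.filter_eq_empty_iff.2 fun x hx hux => hu ?_
      have h1 := hR x hx
      rw [mem_closedBall, dist_eq_norm] at *
      have h2 : ‖u - x‖ ≤ 2 * (s / 2) := norm_le_of _ _ (by positivity) (fun i => by simpa using QQ_mem s hs x u hux i)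
      have h3 : u - c = (u - x) + (x - c) := by abel
      rw [h3]
      refine (norm_add_le _ _).trans ?_
      linarith
    rw [this]; simp

lemma vol_B : volume {x : EuclideanSpace ℝ (Fin 3) | x 0 ^ 4 + x 1 ^ 4 + x 2 ^ 4 ≤ 1} = ENNReal.ofReal VB := by
  have h := MeasureTheory.volume_sum_rpow_le (Fin 3) (p := 4) (by norm_num) 1
  have e : {x : EuclideanSpace ℝ (Fin 3) | x 0 ^ 4 + x 1 ^ 4 + x 2 ^ 4 ≤ 1} =
      (@WithLp.ofLp 2 (Fin 3 → ℝ)) ⁻¹' {x : Fin 3 → ℝ | (∑ i, |x i| ^ (4 : ℝ)) ^ (1 / 4 : ℝ) ≤ 1} := by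
    ext x
    have e4 : ∀ i, |x i| ^ (4 : ℝ) = x i ^ 4 := by
      intro i
      rw [show (4 : ℝ) = (4 : ℕ) by norm_num, Real.rpow_natCast, Even.pow_abs (by decide)]
    have p : ∀ i, 0 ≤ x i ^ 4 := fun i => Even.pow_nonneg (by decide) _
    simp only [Set.mem_ofPred_eq, Set.mem_preimage, e4, Fin.sum_univ_three]
    have h0 := p 0
    have h1 := p 1
    have h2 := p 2
    have hr := Real.rpow_le_rpow_iff (x := x 0 ^ 4 + x 1 ^ 4 + x 2 ^ 4) (y := 1) (z := 1 / 4) (by positivity) (by norm_num) (by norm_num)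
    rw [Real.one_rpow] at hr
    exact hr.symm
  rw [e, (PiLp.volume_preserving_ofLp (Fin 3)).measure_preimage, h]
  · simp [VB]
  · exact (measurableSet_le (by fun_prop) measurable_const).nullMeasurableSet

lemma pack (B X : Set (EuclideanSpace ℝ (Fin 3)))
    (hB : B = {x : EuclideanSpace ℝ (Fin 3) | x 0 ^ 4 + x 1 ^ 4 + x 2 ^ 4 ≤ 1})
    (hX : ∀ x ∈ X, ∀ y ∈ X, x ≠ y → Disjoint ((fun z => x + z) '' interior B) ((fun z => y + z) '' interior B)) :
    ∀ x ∈ X, ∀ y ∈ X, x ≠ y → 16 ≤ (x 0 - y 0) ^ 4 + (x 1 - y 1) ^ 4 + (x 2 - y 2) ^ 4 := by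
  intro x hx y hy hxy
  by_contra hc
  push Not at hc
  have hsub : {x : EuclideanSpace ℝ (Fin 3) | x 0 ^ 4 + x 1 ^ 4 + x 2 ^ 4 < 1} ⊆ interior B := by
    apply interior_maximal
    · intro z hz; rw [hB]; simp only [Set.mem_ofPred_eq] at hz ⊢; exact le_of_lt hz
    · exact isOpen_lt (by fun_prop) continuous_const
  have hd := Set.disjoint_left.1 (hX x hx y hy hxy)
  refine @hd ((1 / 2 : ℝ) • (x + y)) ⟨(1 / 2 : ℝ) • (y - x), hsub ?_, ?_⟩
    ⟨(1 / 2 : ℝ) • (x - y), hsub ?_, ?_⟩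
  · simp only [Set.mem_ofPred_eq, PiLp.smul_apply, PiLp.sub_apply, smul_eq_mul]
    nlinarith
  · simp only; module
  · simp only [Set.mem_ofPred_eq, PiLp.smul_apply, PiLp.sub_apply, smul_eq_mul]
    nlinarith
  · simp only; module

lemma B_norm (z : EuclideanSpace ℝ (Fin 3)) (h : z 0 ^ 4 + z 1 ^ 4 + z 2 ^ 4 ≤ 1) : ‖z‖ ≤ 2 := by
  have p : ∀ i, 0 ≤ z i ^ 4 := fun i => Even.pow_nonneg (by decide) _
  have q : ∀ i, |z i| ≤ 1 := by
    intro i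
    have : z i ^ 4 ≤ 1 := by fin_cases i <;> simp <;> linarith [p 0, p 1, p 2]
    by_contra hc
    push Not at hc
    have h4 : |z i| ^ 4 = z i ^ 4 := Even.pow_abs (by decide) _
    have := one_lt_pow₀ hc (n := 4) (by norm_num)
    linarith
  simpa using norm_le_of z 1 (by norm_num) q

lemma ratio (B X : Set (EuclideanSpace ℝ (Fin 3)))
    (hB : B = {x : EuclideanSpace ℝ (Fin 3) | x 0 ^ 4 + x 1 ^ 4 + x 2 ^ 4 ≤ 1})
    (hX : ∀ x ∈ X, ∀ y ∈ X, x ≠ y → 16 ≤ (x 0 - y 0) ^ 4 + (x 1 - y 1) ^ 4 + (x 2 - y 2) ^ 4)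
    (r s : ℝ) (hr : 0 < r) (hs : 0 < s) (c : EuclideanSpace ℝ (Fin 3)) :
    (volume (closedBall c r ∩ ⋃ x ∈ X, (fun z => x + z) '' B) / volume (closedBall c r)).toReal ≤
      VB * KK * ((s + 2) / s) ^ 3 * ((r + 2 + 2 * s) / r) ^ 3 := by
  set w := volume (ball (0 : EuclideanSpace ℝ (Fin 3)) 1) with hw
  have w0 : w ≠ 0 := (measure_ball_pos volume 0 one_pos).ne'
  have w1 : w ≠ ⊤ := measure_ball_lt_top.ne
  have hball : ∀ R, 0 ≤ R → volume (closedBall c R) = ENNReal.ofReal (R ^ 3) * w := by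
    intro R hR
    rw [Measure.addHaar_closedBall _ _ hR]; simp [hw]
  set W := w.toReal with hW
  have W0 : 0 < W := ENNReal.toReal_pos w0 w1
  have hballR : ∀ R, 0 ≤ R → (volume (closedBall c R)).toReal = R ^ 3 * W := by
    intro R hR
    rw [hball R hR, ENNReal.toReal_mul, ENNReal.toReal_ofReal (by positivity)]
  set M := (s + 2) ^ 3 * KK * ((r + 2 + 2 * s) ^ 3 * W) / s ^ 3 with hM
  have hK := KK_pos
  have M0 : 0 ≤ M := by positivity
  have hcount : ∀ S : Finset (EuclideanSpace ℝ (Fin 3)), (S : Set (EuclideanSpace ℝ (Fin 3))) ⊆ X ∩ closedBall c (r + 2) → (S.card : ℝ) ≤ M := by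
    intro S hS
    have h := count X hX S (fun x hx => (hS hx).1) c (r + 2) s hs (fun x hx => (hS hx).2)
    have h2 := ENNReal.toReal_mono (ENNReal.mul_ne_top ENNReal.ofReal_ne_top measure_closedBall_lt_top.ne) h
    rw [ENNReal.toReal_mul, ENNReal.toReal_mul, ENNReal.toReal_ofReal (by positivity), ENNReal.toReal_ofReal (by positivity),
      hballR _ (by positivity), ENNReal.toReal_natCast] at h2
    rw [hM, le_div_iff₀ (by positivity)]
    exact h2
  have hfin : (X ∩ closedBall c (r + 2)).Finite := by
    by_contra hinf
    obtain ⟨n, hn⟩ := exists_nat_gt M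
    obtain ⟨t, ht, htc⟩ := Set.Infinite.exists_subset_card_eq hinf n
    have := hcount t ht
    rw [htc] at this
    linarith
  have hsub : closedBall c r ∩ ⋃ x ∈ X, (fun z => x + z) '' B ⊆ ⋃ x ∈ hfin.toFinset, (fun z => x + z) '' B := by
    rintro u ⟨hu, hu2⟩
    simp only [Set.mem_iUnion] at hu2 ⊢
    obtain ⟨x, hx, z, hz, hxz⟩ := hu2
    refine ⟨x, ?_, z, hz, hxz⟩
    rw [Set.Finite.mem_toFinset]
    refine ⟨hx, ?_⟩
    have hz2 : ‖z‖ ≤ 2 := B_norm z (by rw [hB] at hz; exact hz)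
    rw [mem_closedBall, dist_eq_norm] at *
    have : x - c = (u - c) - z := by rw [← hxz]; simp only; abel
    rw [this]
    refine (norm_sub_le _ _).trans ?_
    linarith
  have hvol : volume (closedBall c r ∩ ⋃ x ∈ X, (fun z => x + z) '' B) ≤ ENNReal.ofReal (M * VB) := by
    refine (measure_mono hsub).trans ((measure_biUnion_finset_le _ _).trans ?_)
    have : ∀ x ∈ hfin.toFinset, volume ((fun z => x + z) '' B) = ENNReal.ofReal VB := by
      intro x _
      rw [Set.image_add_left, measure_preimage_add, hB, vol_B]
    rw [Finset.sum_congr rfl this, Finset.sum_const, nsmul_eq_mul, ← ENNReal.ofReal_natCast, ← ENNReal.ofReal_mul (by positivity)]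
    apply ENNReal.ofReal_le_ofReal
    refine mul_le_mul_of_nonneg_right (hcount _ ?_) VB_pos.le
    simp
  rw [ENNReal.toReal_div, hballR r hr.le, div_le_iff₀ (by positivity)]
  have h3 := ENNReal.toReal_mono ENNReal.ofReal_ne_top hvol
  rw [ENNReal.toReal_ofReal (mul_nonneg M0 VB_pos.le)] at h3
  refine h3.trans (le_of_eq ?_)
  rw [hM]; field_simp

lemma final (B X : Set (EuclideanSpace ℝ (Fin 3)))
    (hB : B = {x : EuclideanSpace ℝ (Fin 3) | x 0 ^ 4 + x 1 ^ 4 + x 2 ^ 4 ≤ 1})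
    (hX : ∀ x ∈ X, ∀ y ∈ X, x ≠ y → Disjoint ((fun z => x + z) '' interior B) ((fun z => y + z) '' interior B)) :
    Filter.limsup (fun r : ℝ => ⨆ c : EuclideanSpace ℝ (Fin 3),
    (volume (closedBall c r ∩ ⋃ x ∈ X, (fun z => x + z) '' B) /
      volume (closedBall c r)).toReal) Filter.atTop ≤ 0.8743 := by
  have hp := pack B X hB hX
  have hlim : Tendsto (fun r : ℝ => VB * KK * ((Real.sqrt r + 2) / Real.sqrt r) ^ 3 * ((r + 2 + 2 * Real.sqrt r) / r) ^ 3) atTop (nhds (VB * KK)) := by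
    have i1 : Tendsto (fun r : ℝ => (Real.sqrt r)⁻¹) atTop (nhds 0) := tendsto_inv_atTop_zero.comp Real.tendsto_sqrt_atTop
    have h1 : Tendsto (fun r : ℝ => VB * KK * (1 + 2 * (Real.sqrt r)⁻¹) ^ 3 * (1 + 2 * r⁻¹ + 2 * (Real.sqrt r)⁻¹) ^ 3) atTop
        (nhds (VB * KK * (1 + 2 * 0) ^ 3 * (1 + 2 * 0 + 2 * 0) ^ 3)) :=
      (((i1.const_mul 2).const_add 1).pow 3).const_mul _ |>.mul
        ((((tendsto_inv_atTop_zero.const_mul 2).const_add 1).add (i1.const_mul 2)).pow 3)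
    have e : VB * KK * (1 + 2 * 0) ^ 3 * (1 + 2 * 0 + 2 * 0) ^ 3 = VB * KK := by ring
    rw [e] at h1
    refine h1.congr' ?_
    filter_upwards [eventually_gt_atTop 0] with r hr
    have hs : 0 < Real.sqrt r := Real.sqrt_pos.2 hr
    have e1 : (Real.sqrt r + 2) / Real.sqrt r = 1 + 2 * (Real.sqrt r)⁻¹ := by field_simp
    have e2 : (r + 2 + 2 * Real.sqrt r) / r = 1 + 2 * r⁻¹ + 2 * (Real.sqrt r)⁻¹ := by
      have := Real.sq_sqrt hr.le
      have h3 : Real.sqrt r / r = (Real.sqrt r)⁻¹ := by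
        nth_rewrite 2 [← this]; field_simp
      rw [add_div, add_div, div_self hr.ne', mul_div_assoc, h3]; ring
    rw [e1, e2]
  refine Filter.limsup_le_of_le ?_ ?_
  · refine Filter.IsCoboundedUnder.of_frequently_ge (a := 0) (Filter.Frequently.of_forall fun r => ?_)
    exact Real.iSup_nonneg fun c => ENNReal.toReal_nonneg
  · filter_upwards [hlim.eventually_lt_const num, eventually_gt_atTop 0] with r h1 h2
    exact ciSup_le fun c => (ratio B X hB hp r _ h2 (Real.sqrt_pos.2 h2) c).trans h1.le

end SB

/-- Every translative packing of the superball `B⁴₃` has upper density at most `0.8743`. -/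
theorem superball4_translative_packing_bound
    (B : Set (EuclideanSpace ℝ (Fin 3)))
    (hB : B = {x : EuclideanSpace ℝ (Fin 3) | x 0 ^ 4 + x 1 ^ 4 + x 2 ^ 4 ≤ 1})
    (X : Set (EuclideanSpace ℝ (Fin 3))) (hX : IsTranslativePacking B X) :
    packingUpperDensity B X ≤ 0.8743 := by
  exact SB.final B X hB hX
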